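/- Let n ≥ 1. There exist constants C = C(n) > 0, α = α(n) ∈ (0, 1) and c = c(n) ∈ (0, 1), depending only on n, such that the following holds. Let ũ be continuously differentiable on the closed upper half-space {x ∈ ℝ^{n+1} : x_{n+1} ≥ 0} and harmonic on the open upper half-space ℝ^{n+1}_+, and set u(x') := ũ(x', 0) and g(x') := ∂_{n+1}ũ(x', 0) for x' ∈ ℝⁿ. Then for every x₀ ∈ ℝⁿ × {0} and every R > 0, ‖ũ‖_{L²(B⁺_{cR}(x₀))} ≤ C (‖ũ‖_{L²(B⁺_{16R}(x₀))} + R^{1/2} ‖u‖_{L²(B'_{16R}(x₀))})^α · (R^{3/2} ‖g‖_{L²(B'_{16R}(x₀))} + R^{1/2} ‖u‖_{L²(B'_{16R}(x₀))})^{1−α}. -/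

import Mathlib

open MeasureTheory

/-- The (coordinate-wise) Laplacian of `f : ℝ^m → ℝ` at `x`:
`∑ i, ∂²f/∂xᵢ²` computed via iterated Fréchet derivatives in coordinate directions. -/
noncomputable def lapl {m : ℕ} (f : EuclideanSpace ℝ (Fin m) → ℝ)
    (x : EuclideanSpace ℝ (Fin m)) : ℝ :=
  ∑ i : Fin m, fderiv ℝ (fun y => fderiv ℝ f y (EuclideanSpace.single i 1)) x
    (EuclideanSpace.single i 1)

/-- `f` is harmonic on the (open) set `U`: it is `C²` on `U` and its Laplacian vanishes on `U`. -/
def HarmonicOnSet {m : ℕ} (f : EuclideanSpace ℝ (Fin m) → ℝ)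
    (U : Set (EuclideanSpace ℝ (Fin m))) : Prop :=
  ContDiffOn ℝ 2 f U ∧ ∀ x ∈ U, lapl f x = 0

/-- The south pole `s = (0, …, 0, -1)` of the unit sphere in `ℝ^{n+1}`. -/
noncomputable def southPole (n : ℕ) : EuclideanSpace ℝ (Fin (n+1)) :=
  -(EuclideanSpace.single (Fin.last n) 1)

/-- The map `Φ(z) = 2 (z - s)/‖z - s‖² + s`. -/
noncomputable def Phi {n : ℕ} (z : EuclideanSpace ℝ (Fin (n+1))) :
    EuclideanSpace ℝ (Fin (n+1)) :=
  (2 / ‖z - southPole n‖ ^ 2) • (z - southPole n) + southPole n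

/-- The Kelvin transform `K[w](z) = 2^{(n-1)/2} ‖z - s‖^{1-n} w(Φ(z))`. -/
noncomputable def kelvin {n : ℕ} (w : EuclideanSpace ℝ (Fin (n+1)) → ℝ)
    (z : EuclideanSpace ℝ (Fin (n+1))) : ℝ :=
  2 ^ (((n : ℝ) - 1) / 2) * ‖z - southPole n‖ ^ ((1 : ℝ) - n) * w (Phi z)

/-- Embed `ℝⁿ` into `ℝ^{n+1}` as the hyperplane `x_{n+1} = 0`. -/
noncomputable def emb {n : ℕ} (x' : EuclideanSpace ℝ (Fin n)) :
    EuclideanSpace ℝ (Fin (n+1)) :=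
  (WithLp.equiv 2 (Fin (n+1) → ℝ)).symm
    (Fin.snoc ((WithLp.equiv 2 (Fin n → ℝ)) x') 0)

/-- The point `(x', t) ∈ ℝ^{n+1}` for `x' ∈ ℝⁿ` and `t ∈ ℝ`. -/
noncomputable def embt {n : ℕ} (x' : EuclideanSpace ℝ (Fin n)) (t : ℝ) :
    EuclideanSpace ℝ (Fin (n+1)) :=
  (WithLp.equiv 2 (Fin (n+1) → ℝ)).symm
    (Fin.snoc ((WithLp.equiv 2 (Fin n → ℝ)) x') t)

/-- The `Lᵖ` norm `(∫_S |f|ᵖ)^{1/p}` of `f` over a set `S` (w.r.t. Lebesgue measure). -/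
noncomputable def LpnormOn {m : ℕ} (f : EuclideanSpace ℝ (Fin m) → ℝ) (p : ℝ)
    (S : Set (EuclideanSpace ℝ (Fin m))) : ℝ :=
  (∫⁻ x in S, ENNReal.ofReal (|f x| ^ p)).toReal ^ (1 / p)

/-- The half ball `B⁺_R(x₀) = {x ∈ ℝ^{n+1} : x_{n+1} > 0, |x - x₀| ≤ R}`. -/
def Bplus {n : ℕ} (x0 : EuclideanSpace ℝ (Fin (n+1))) (R : ℝ) :
    Set (EuclideanSpace ℝ (Fin (n+1))) :=
  {x | 0 < x (Fin.last n) ∧ dist x x0 ≤ R}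

/-- The boundary ball `B'_R(x₀) = {x' ∈ ℝⁿ : |(x', 0) - x₀| ≤ R}`. -/
def Bprime {n : ℕ} (x0 : EuclideanSpace ℝ (Fin (n+1))) (R : ℝ) :
    Set (EuclideanSpace ℝ (Fin n)) :=
  {x' | dist (emb x') x0 ≤ R}

/-- Euclidean space. -/
abbrev Euc (m : ℕ) := EuclideanSpace ℝ (Fin m)

/-- The open upper half-space. -/
def upperHalf (n : ℕ) : Set (Euc (n + 1)) := {x | 0 < x (Fin.last n)}

/-- The closed upper half-space. -/
def closedHalf (n : ℕ) : Set (Euc (n + 1)) := {x | 0 ≤ x (Fin.last n)}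

theorem continuous_coord {m : ℕ} (i : Fin m) : Continuous fun x : Euc m => x i := by
  fun_prop

theorem isOpen_upperHalf (n : ℕ) : IsOpen (upperHalf n) :=
  isOpen_lt continuous_const (continuous_coord _)

theorem isClosed_closedHalf (n : ℕ) : IsClosed (closedHalf n) :=
  isClosed_le continuous_const (continuous_coord _)

theorem upperHalf_subset_closedHalf (n : ℕ) : upperHalf n ⊆ closedHalf n :=
  fun x hx => show 0 ≤ x (Fin.last n) from le_of_lt hx

theorem uniqueDiffOn_closedHalf (n : ℕ) : UniqueDiffOn ℝ (closedHalf n) := by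
  refine uniqueDiffOn_convex ?_ ?_
  · intro x hx y hy a b ha hb _
    simp only [closedHalf, Set.mem_ofPred_eq, PiLp.add_apply, PiLp.smul_apply, smul_eq_mul] at *
    positivity
  · refine ⟨EuclideanSpace.single (Fin.last n) 1, ?_⟩
    refine interior_maximal (upperHalf_subset_closedHalf n) (isOpen_upperHalf n) ?_
    simp [upperHalf]

theorem closedHalf_mem_nhds {n : ℕ} {x : Euc (n + 1)} (hx : x ∈ upperHalf n) :
    closedHalf n ∈ nhds x :=
  Filter.mem_of_superset ((isOpen_upperHalf n).mem_nhds hx) (upperHalf_subset_closedHalf n)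

theorem emb_apply_last {n : ℕ} (x : Euc n) : emb x (Fin.last n) = 0 := by
  simp [emb]

theorem emb_apply_castSucc {n : ℕ} (x : Euc n) (i : Fin n) : emb x i.castSucc = x i := by
  simp [emb]

theorem emb_mem_closedHalf {n : ℕ} (x : Euc n) : emb x ∈ closedHalf n := by
  simp [closedHalf, emb_apply_last]

theorem emb_toLp {n : ℕ} (x : Fin n → ℝ) :
    emb (WithLp.toLp 2 x) = WithLp.toLp 2 ((Fin.last n).insertNth (0 : ℝ) x) := by
  simp [emb, Fin.insertNth_last']

theorem continuous_emb (n : ℕ) : Continuous (emb : Euc n → Euc (n + 1)) := by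
  unfold emb
  refine (PiLp.continuous_toLp 2 _).comp ?_
  refine continuous_pi fun i => ?_
  refine Fin.lastCases ?_ (fun j => ?_) i
  · simpa using continuous_const
  · simpa using continuous_coord j

/-- Pointwise divergence identity behind Green's second identity. -/
theorem fderiv_green_component {m : ℕ} {u ψ : Euc m → ℝ} {y : Euc m}
    (hu : ContDiffAt ℝ 2 u y) (hψ : ContDiffAt ℝ 2 ψ y) (e : Euc m) :
    DifferentiableAt ℝ (fun z => ψ z * fderiv ℝ u z e - u z * fderiv ℝ ψ z e) y ∧
    fderiv ℝ (fun z => ψ z * fderiv ℝ u z e - u z * fderiv ℝ ψ z e) y e =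
      ψ y * fderiv ℝ (fun z => fderiv ℝ u z e) y e
        - u y * fderiv ℝ (fun z => fderiv ℝ ψ z e) y e := by
  have d (f : Euc m → ℝ) (hf : ContDiffAt ℝ 2 f y) :
      DifferentiableAt ℝ f y ∧ DifferentiableAt ℝ (fun z => fderiv ℝ f z e) y := by
    refine ⟨hf.differentiableAt (by norm_num), ?_⟩
    have : ContDiffAt ℝ 1 (fderiv ℝ f) y := hf.fderiv_right (by norm_num)
    exact (this.differentiableAt (by norm_num)).clm_apply (differentiableAt_const e)
  obtain ⟨u1, u2⟩ := d u hu
  obtain ⟨p1, p2⟩ := d ψ hψ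
  have h := (p1.hasFDerivAt.mul u2.hasFDerivAt).sub (u1.hasFDerivAt.mul p2.hasFDerivAt)
  refine ⟨h.differentiableAt, ?_⟩
  erw [h.fderiv]
  simp
  ring

theorem green_halfspace {n : ℕ} {u : Euc (n + 1) → ℝ} (hu : ContDiffOn ℝ 1 u (closedHalf n))
    (hh : HarmonicOnSet u (upperHalf n)) {ψ : Euc (n + 1) → ℝ} (hψ : ContDiff ℝ 2 ψ)
    {r : ℝ} (hr : 0 ≤ r) (hs : tsupport ψ ⊆ Metric.closedBall 0 r) :
    ∫ y in upperHalf n, u y * lapl ψ y =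
      ∫ y' : Euc n, (ψ (emb y') *
          fderivWithin ℝ u (closedHalf n) (emb y') (EuclideanSpace.single (Fin.last n) 1)
        - u (emb y') * fderiv ℝ ψ (emb y') (EuclideanSpace.single (Fin.last n) 1)) := by
  set T : (Fin (n + 1) → ℝ) → Euc (n + 1) := WithLp.toLp 2 with hT
  set e : Fin (n + 1) → Euc (n + 1) := fun i => EuclideanSpace.single i 1 with he
  set a : Fin (n + 1) → ℝ := fun i => if i = Fin.last n then 0 else -(r + 1) with ha
  set b : Fin (n + 1) → ℝ := fun _ => r + 1 with hb
  set G : Fin (n + 1) → Euc (n + 1) → ℝ := fun i y =>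
    ψ y * fderivWithin ℝ u (closedHalf n) y (e i) - u y * fderiv ℝ ψ y (e i) with hG
  have hψd : ContDiff ℝ 1 (fderiv ℝ ψ) := hψ.fderiv_right (by norm_num)
  have hlapc : Continuous (lapl ψ) := by
    unfold lapl
    refine continuous_finsetSum _ fun i _ => ?_
    have h1 : ContDiff ℝ 1 (fun y => fderiv ℝ ψ y (EuclideanSpace.single i 1)) :=
      hψd.clm_apply contDiff_const
    exact (h1.continuous_fderiv (by norm_num)).clm_apply continuous_const
  have hψ0 : ∀ y : Euc (n + 1), r < ‖y‖ → ψ y = 0 ∧ fderiv ℝ ψ y = 0 ∧ lapl ψ y = 0 := by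
    intro y hy
    have hy' : y ∉ tsupport ψ := fun h => by
      have := hs h
      simp at this
      linarith
    have h0 : ψ =ᶠ[nhds y] fun _ => 0 := notMem_tsupport_iff_eventuallyEq.mp hy'
    have h1 : ∀ᶠ z in nhds y, fderiv ℝ ψ z = 0 := by
      filter_upwards [h0.eventuallyEq_nhds] with z hz
      rw [hz.fderiv_eq]; simp
    refine ⟨h0.self_of_nhds, h1.self_of_nhds, ?_⟩
    unfold lapl
    refine Finset.sum_eq_zero fun i _ => ?_
    have : (fun z => fderiv ℝ ψ z (EuclideanSpace.single i 1)) =ᶠ[nhds y] fun _ => 0 := by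
      filter_upwards [h1] with z hz
      simp [hz]
    rw [this.fderiv_eq]; simp
  have hnorm : ∀ (x : Fin (n + 1) → ℝ) i, |x i| ≤ ‖T x‖ := fun x i => by
    simpa [hT] using PiLp.norm_apply_le (T x) i
  have hG0 : ∀ i y, r < ‖y‖ → G i y = 0 := by
    intro i y hy
    simp [hG, (hψ0 y hy).1, (hψ0 y hy).2.1]
  have hTc : Continuous T := PiLp.continuous_toLp 2 _
  have hab : a ≤ b := by
    intro i
    simp only [ha, hb]
    split_ifs <;> linarith
  have hTcl : Set.MapsTo T (Set.Icc a b) (closedHalf n) := by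
    intro x hx
    have := hx.1 (Fin.last n)
    simpa [ha, closedHalf, hT] using this
  have hTop : ∀ x ∈ Set.univ.pi fun i => Set.Ioo (a i) (b i), T x ∈ upperHalf n := by
    intro x hx
    have := (hx (Fin.last n) trivial).1
    simpa [ha, upperHalf, hT] using this
  have hGc : ∀ i, ContinuousOn (G i) (closedHalf n) := by
    intro i
    refine (hψ.continuous.continuousOn.mul ?_).sub (hu.continuousOn.mul ?_)
    · exact (hu.continuousOn_fderivWithin (uniqueDiffOn_closedHalf n) le_rfl).clm_apply
        continuousOn_const
    · exact (hψd.continuous.clm_apply continuous_const).continuousOn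
  have hGd : ∀ i, ∀ y ∈ upperHalf n, DifferentiableAt ℝ (G i) y ∧ fderiv ℝ (G i) y (e i) =
      ψ y * fderiv ℝ (fun z => fderiv ℝ u z (e i)) y (e i)
        - u y * fderiv ℝ (fun z => fderiv ℝ ψ z (e i)) y (e i) := by
    intro i y hy
    have hev : G i =ᶠ[nhds y] fun z => ψ z * fderiv ℝ u z (e i) - u z * fderiv ℝ ψ z (e i) := by
      filter_upwards [(isOpen_upperHalf n).mem_nhds hy] with z hz
      simp only [hG]
      rw [fderivWithin_of_mem_nhds (closedHalf_mem_nhds hz)]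
    have hu2 : ContDiffAt ℝ 2 u y := hh.1.contDiffAt ((isOpen_upperHalf n).mem_nhds hy)
    obtain ⟨h1, h2⟩ := fderiv_green_component hu2 hψ.contDiffAt (e i)
    exact ⟨h1.congr_of_eventuallyEq hev, by rw [hev.fderiv_eq, h2]⟩
  have hTd : ∀ x, HasFDerivAt T
      ((PiLp.continuousLinearEquiv 2 ℝ (fun _ : Fin (n + 1) => ℝ)).symm :
        (Fin (n + 1) → ℝ) →L[ℝ] Euc (n + 1)) x := fun x =>
    ((PiLp.continuousLinearEquiv 2 ℝ (fun _ : Fin (n + 1) => ℝ)).symm :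
        (Fin (n + 1) → ℝ) →L[ℝ] Euc (n + 1)).hasFDerivAt
  have hdiv : ∀ x ∈ Set.univ.pi fun i => Set.Ioo (a i) (b i),
      ∑ i, fderiv ℝ (G i ∘ T) x (Pi.single i 1) = -(u (T x) * lapl ψ (T x)) := by
    intro x hx
    have h1 : ∀ i, fderiv ℝ (G i ∘ T) x (Pi.single i 1) = fderiv ℝ (G i) (T x) (e i) := by
      intro i
      rw [((hGd i (T x) (hTop x hx)).1.hasFDerivAt.comp x (hTd x)).fderiv]
      rfl
    have h2 : lapl u (T x) = 0 := hh.2 _ (hTop x hx)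
    simp only [h1, fun i => (hGd i (T x) (hTop x hx)).2, Finset.sum_sub_distrib, ← Finset.mul_sum]
    change ψ (T x) * lapl u (T x) - u (T x) * lapl ψ (T x) = _
    rw [h2]; ring
  have hae : (Set.univ.pi fun i => Set.Ioo (a i) (b i)) =ᵐ[volume] Set.Icc a b :=
    Measure.univ_pi_Ioo_ae_eq_Icc
  have hmeas : MeasurableSet (Set.univ.pi fun i => Set.Ioo (a i) (b i)) :=
    MeasurableSet.univ_pi fun i => measurableSet_Ioo
  have hcont : ContinuousOn (fun x => -(u (T x) * lapl ψ (T x))) (Set.Icc a b) :=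
    ((hu.continuousOn.comp hTc.continuousOn hTcl).mul (hlapc.comp hTc).continuousOn).neg
  have hGint : IntegrableOn (fun x => ∑ i, fderiv ℝ (G i ∘ T) x (Pi.single i 1))
      (Set.Icc a b) := by
    refine IntegrableOn.congr_set_ae ?_ hae.symm
    refine (IntegrableOn.congr_set_ae ?_ hae).congr_fun (fun x hx => (hdiv x hx).symm) hmeas
    exact hcont.integrableOn_compact isCompact_Icc
  have key := integral_divergence_of_hasFDerivAt_off_countable' a b hab (fun i => G i ∘ T)
    (fun i x => fderiv ℝ (G i ∘ T) x) ∅ Set.countable_empty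
    (fun i => (hGc i).comp hTc.continuousOn hTcl)
    (fun x hx i => ((hGd i (T x) (hTop x hx.1)).1.comp x
      (hTd x).differentiableAt).hasFDerivAt) hGint
  have hleft : ∫ x in Set.Icc a b, ∑ i, fderiv ℝ (G i ∘ T) x (Pi.single i 1) =
      -∫ y in upperHalf n, u y * lapl ψ y := by
    rw [← setIntegral_congr_set hae, setIntegral_congr_fun hmeas hdiv, integral_neg]
    congr 1
    rw [← (PiLp.volume_preserving_toLp (Fin (n + 1))).setIntegral_preimage_emb
      (MeasurableEquiv.toLp 2 (Fin (n + 1) → ℝ)).measurableEmbedding]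
    symm
    refine setIntegral_eq_of_subset_of_forall_sdiff_eq_zero
      ((isOpen_upperHalf n).preimage hTc).measurableSet hTop ?_
    rintro x ⟨hx1, hx2⟩
    have hx1' : 0 < x (Fin.last n) := hx1
    have : r < ‖T x‖ := by
      by_contra hcon
      push Not at hcon
      refine hx2 fun i _ => ?_
      have h3 := abs_le.mp ((hnorm x i).trans hcon)
      simp only [ha, hb]
      split_ifs with hi
      · subst hi; exact ⟨hx1', by linarith⟩
      · exact ⟨by linarith, by linarith⟩
    rw [(hψ0 _ this).2.2, mul_zero]
  have hface : ∀ i : Fin (n + 1), ∀ c : ℝ, r < |c| → ∀ x : Fin n → ℝ,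
      (G i ∘ T) (i.insertNth c x) = 0 := by
    intro i c hc x
    refine hG0 i _ (lt_of_lt_of_le hc ?_)
    simpa using hnorm (i.insertNth c x) i
  have hright : ∑ i : Fin (n + 1),
      ((∫ x in Set.Icc (a ∘ i.succAbove) (b ∘ i.succAbove), (G i ∘ T) (i.insertNth (b i) x)) -
        ∫ x in Set.Icc (a ∘ i.succAbove) (b ∘ i.succAbove), (G i ∘ T) (i.insertNth (a i) x)) =
      -∫ y' : Euc n, G (Fin.last n) (emb y') := by
    rw [Finset.sum_eq_single (Fin.last n)]
    · have h1 : ∀ x, (G (Fin.last n) ∘ T) ((Fin.last n).insertNth (b (Fin.last n)) x) = 0 := by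
        refine hface _ _ ?_
        simp only [hb]
        rw [abs_of_nonneg] <;> linarith
      simp only [h1, integral_zero, zero_sub]
      congr 1
      rw [← (PiLp.volume_preserving_toLp (Fin n)).integral_comp
        (MeasurableEquiv.toLp 2 (Fin n → ℝ)).measurableEmbedding]
      simp only [emb_toLp]
      have h2 : a (Fin.last n) = 0 := by simp [ha]
      rw [h2]
      refine setIntegral_eq_integral_of_forall_compl_eq_zero fun x hx => ?_
      refine hG0 _ _ ?_
      by_contra hcon
      push Not at hcon
      apply hx
      have h3 : ∀ i : Fin n, -(r + 1) ≤ x i ∧ x i ≤ r + 1 := fun i => by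
        have h4 := abs_le.mp ((hnorm ((Fin.last n).insertNth (0 : ℝ) x)
          ((Fin.last n).succAbove i)).trans hcon)
        rw [Fin.insertNth_apply_succAbove] at h4
        exact ⟨by linarith, by linarith⟩
      refine ⟨fun i => ?_, fun i => (h3 i).2⟩
      simp only [ha, Function.comp, Fin.succAbove_ne, if_false]
      exact (h3 i).1
    · intro i _ hi
      have h1 : ∀ x, (G i ∘ T) (i.insertNth (b i) x) = 0 := by
        refine hface _ _ ?_
        simp only [hb]
        rw [abs_of_nonneg] <;> linarith
      have h2 : ∀ x, (G i ∘ T) (i.insertNth (a i) x) = 0 := by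
        refine hface _ _ ?_
        simp only [ha, hi, if_false]
        rw [abs_neg, abs_of_nonneg] <;> linarith
      simp only [h1, h2, integral_zero, sub_zero]
    · simp
  rw [hleft, hright] at key
  exact neg_injective key

/-- The power `s ^ (-(n + 1) / 2)`, the derivative of `radialPotential n`. -/
noncomputable def radialKernel (n : ℕ) (s : ℝ) : ℝ := s ^ (-((n : ℝ) + 1) / 2)

/-- The Newtonian potential of `ℝ^{n+1}` (up to a constant) as a function of the squared norm. -/
noncomputable def radialPotential (n : ℕ) (s : ℝ) : ℝ :=
  if n = 1 then Real.log s else 2 / (1 - (n : ℝ)) * s ^ ((1 - (n : ℝ)) / 2)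

theorem hasDerivAt_radialPotential (n : ℕ) {s : ℝ} (hs : 0 < s) :
    HasDerivAt (radialPotential n) (radialKernel n s) s := by
  unfold radialPotential radialKernel
  split_ifs with h
  · subst h
    refine (Real.hasDerivAt_log hs.ne').congr_deriv ?_
    norm_num [Real.rpow_neg_one]
  · have h1 : (1 : ℝ) - n ≠ 0 := by
      intro h2
      apply h
      exact_mod_cast (sub_eq_zero.mp h2).symm
    refine ((Real.hasDerivAt_rpow_const (p := (1 - (n : ℝ)) / 2) (Or.inl hs.ne')).const_mul
      (2 / (1 - (n : ℝ)))).congr_deriv ?_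
    rw [show (1 - (n : ℝ)) / 2 - 1 = -((n : ℝ) + 1) / 2 by ring]
    field_simp

theorem hasDerivAt_radialKernel (n : ℕ) {s : ℝ} (hs : 0 < s) :
    HasDerivAt (radialKernel n)
      (-((n : ℝ) + 1) / 2 * s ^ (-((n : ℝ) + 1) / 2 - 1)) s :=
  Real.hasDerivAt_rpow_const (Or.inl hs.ne')

theorem contDiffAt_radialPotential (n : ℕ) {s : ℝ} (hs : 0 < s) :
    ContDiffAt ℝ 2 (radialPotential n) s := by
  unfold radialPotential
  split_ifs
  · exact Real.contDiffAt_log.2 hs.ne'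
  · exact contDiffAt_const.mul (Real.contDiffAt_rpow_const_of_ne hs.ne')

theorem hasFDerivAt_comp_sq_dist {m : ℕ} {F : ℝ → ℝ} {F' : ℝ} {x y : Euc m} {δ : ℝ}
    (hF : HasDerivAt F F' (‖y - x‖ ^ 2 + δ)) :
    HasFDerivAt (fun z => F (‖z - x‖ ^ 2 + δ)) (F' • (2 • innerSL ℝ (y - x))) y := by
  have h1 : HasFDerivAt (fun z : Euc m => ‖z - x‖ ^ 2 + δ) (2 • innerSL ℝ (y - x)) y := by
    exact ((hasFDerivAt_id (𝕜 := ℝ) y).sub_const x).norm_sq.add_const δ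
  exact hF.comp_hasFDerivAt y h1

theorem fderiv_comp_sq_dist_single {m : ℕ} {F : ℝ → ℝ} {F' : ℝ} {x y : Euc m} {δ : ℝ}
    (hF : HasDerivAt F F' (‖y - x‖ ^ 2 + δ)) (i : Fin m) :
    fderiv ℝ (fun z => F (‖z - x‖ ^ 2 + δ)) y (EuclideanSpace.single i 1) =
      F' * (2 * (y i - x i)) := by
  rw [(hasFDerivAt_comp_sq_dist hF).fderiv]
  simp [EuclideanSpace.inner_single_right]

theorem lapl_radialPotential {n : ℕ} (x y : Euc (n + 1)) {δ : ℝ} (hδ : 0 < δ) :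
    lapl (fun z => radialPotential n (‖z - x‖ ^ 2 + δ)) y =
      2 * (n + 1) * δ * (‖y - x‖ ^ 2 + δ) ^ (-((n : ℝ) + 1) / 2 - 1) := by
  have hpos : ∀ z : Euc (n + 1), 0 < ‖z - x‖ ^ 2 + δ := fun z => by positivity
  unfold lapl
  simp only [fun (z : Euc (n + 1)) i =>
    fderiv_comp_sq_dist_single (hasDerivAt_radialPotential n (hpos z)) i]
  have h2 : ∀ i, fderiv ℝ (fun z : Euc (n + 1) =>
      radialKernel n (‖z - x‖ ^ 2 + δ) * (2 * (z i - x i))) y (EuclideanSpace.single i 1) =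
      -((n : ℝ) + 1) / 2 * (‖y - x‖ ^ 2 + δ) ^ (-((n : ℝ) + 1) / 2 - 1) * 4 * (y i - x i) ^ 2
        + 2 * radialKernel n (‖y - x‖ ^ 2 + δ) := by
    intro i
    have ha := hasFDerivAt_comp_sq_dist (hasDerivAt_radialKernel n (hpos y))
    have hb : HasFDerivAt (fun z : Euc (n + 1) => 2 * (z i - x i))
        ((2 : ℝ) • (EuclideanSpace.proj i : Euc (n + 1) →L[ℝ] ℝ)) y :=
      ((EuclideanSpace.proj (𝕜 := ℝ) i).hasFDerivAt.sub_const (x i)).const_mul 2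
    erw [(ha.mul hb).fderiv]
    simp [EuclideanSpace.inner_single_right]
    ring
  simp only [h2, Finset.sum_add_distrib, ← Finset.mul_sum]
  have h3 : ∑ i, (y i - x i) ^ 2 = ‖y - x‖ ^ 2 := by
    rw [EuclideanSpace.real_norm_sq_eq]; simp
  have h4 : radialKernel n (‖y - x‖ ^ 2 + δ) =
      (‖y - x‖ ^ 2 + δ) ^ (-((n : ℝ) + 1) / 2 - 1) * (‖y - x‖ ^ 2 + δ) := by
    unfold radialKernel
    rw [← Real.rpow_add_one (hpos y).ne']
    congr 1; ring
  rw [h3, h4]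
  simp
  ring

theorem lapl_mul {m : ℕ} {χ f : Euc m → ℝ} (hχ : ContDiff ℝ 2 χ) (hf : ContDiff ℝ 2 f)
    (y : Euc m) :
    lapl (fun z => χ z * f z) y = χ y * lapl f y
      + 2 * ∑ i, fderiv ℝ χ y (EuclideanSpace.single i 1) *
          fderiv ℝ f y (EuclideanSpace.single i 1)
      + f y * lapl χ y := by
  have d (g : Euc m → ℝ) (hg : ContDiff ℝ 2 g) (z e : Euc m) :
      DifferentiableAt ℝ g z ∧ DifferentiableAt ℝ (fun z => fderiv ℝ g z e) z := by
    refine ⟨hg.differentiable (by norm_num) z, ?_⟩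
    have : ContDiff ℝ 1 (fderiv ℝ g) := hg.fderiv_right (by norm_num)
    exact (this.differentiable (by norm_num) z).clm_apply (differentiableAt_const e)
  unfold lapl
  rw [Finset.mul_sum, Finset.mul_sum, Finset.mul_sum, ← Finset.sum_add_distrib,
    ← Finset.sum_add_distrib]
  refine Finset.sum_congr rfl fun i _ => ?_
  set e : Euc m := EuclideanSpace.single i 1
  have h1 : ∀ z, fderiv ℝ (fun z => χ z * f z) z e =
      χ z * fderiv ℝ f z e + f z * fderiv ℝ χ z e := fun z => by
    rw [fderiv_fun_mul (d χ hχ z e).1 (d f hf z e).1]; simp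
  simp only [h1]
  obtain ⟨a1, a2⟩ := d χ hχ y e
  obtain ⟨b1, b2⟩ := d f hf y e
  rw [fderiv_fun_add (a1.fun_mul b2) (b1.fun_mul a2), fderiv_fun_mul a1 b2, fderiv_fun_mul b1 a2]
  simp
  ring

theorem green_regularized {n : ℕ} {u : Euc (n + 1) → ℝ} (hu : ContDiffOn ℝ 1 u (closedHalf n))
    (hh : HarmonicOnSet u (upperHalf n)) {χ : Euc (n + 1) → ℝ} (hχ : ContDiff ℝ 2 χ)
    {r : ℝ} (hr : 0 ≤ r) (hs : tsupport χ ⊆ Metric.closedBall 0 r) (x : Euc (n + 1))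
    {δ : ℝ} (hδ : 0 < δ) :
    ∫ y in upperHalf n, (χ y * u y *
          (2 * (n + 1) * δ * (‖y - x‖ ^ 2 + δ) ^ (-((n : ℝ) + 1) / 2 - 1))
        + radialKernel n (‖y - x‖ ^ 2 + δ) * (4 * u y *
          ∑ i, fderiv ℝ χ y (EuclideanSpace.single i 1) * (y i - x i))
        + radialPotential n (‖y - x‖ ^ 2 + δ) * (u y * lapl χ y)) =
      ∫ y' : Euc n, (radialPotential n (‖emb y' - x‖ ^ 2 + δ) * (χ (emb y') *
          fderivWithin ℝ u (closedHalf n) (emb y') (EuclideanSpace.single (Fin.last n) 1)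
          - u (emb y') * fderiv ℝ χ (emb y') (EuclideanSpace.single (Fin.last n) 1))
        + radialKernel n (‖emb y' - x‖ ^ 2 + δ) *
          (2 * x (Fin.last n) * (χ (emb y') * u (emb y')))) := by
  have hpos : ∀ z : Euc (n + 1), 0 < ‖z - x‖ ^ 2 + δ := fun z => by positivity
  set f : Euc (n + 1) → ℝ := fun z => radialPotential n (‖z - x‖ ^ 2 + δ) with hfdef
  have hf : ContDiff ℝ 2 f := by
    rw [contDiff_iff_contDiffAt]
    intro y
    refine ContDiffAt.comp (g := radialPotential n) y (contDiffAt_radialPotential n (hpos y)) ?_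
    exact (((contDiff_id.sub contDiff_const).norm_sq ℝ).add contDiff_const).contDiffAt
  have hfd : ∀ (y : Euc (n + 1)) i, fderiv ℝ f y (EuclideanSpace.single i 1) =
      radialKernel n (‖y - x‖ ^ 2 + δ) * (2 * (y i - x i)) := fun y i =>
    fderiv_comp_sq_dist_single (hasDerivAt_radialPotential n (hpos y)) i
  have key := green_halfspace hu hh (hχ.mul hf) hr
    ((closure_mono (Function.support_mul_subset_left χ f)).trans hs)
  simp only [lapl_mul hχ hf] at key
  convert key using 1
  · refine integral_congr_ae (Filter.Eventually.of_forall fun y => ?_)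
    simp only [hfdef, lapl_radialPotential x y hδ]
    simp only [← hfdef, hfd]
    simp only [Finset.mul_sum, mul_add]
    congr 1
    · congr 1
      · ring
      · refine Finset.sum_congr rfl fun i _ => ?_
        ring
    · ring
  · refine integral_congr_ae (Filter.Eventually.of_forall fun y => ?_)
    simp only
    rw [fderiv_fun_mul (hχ.differentiable (by norm_num) _) (hf.differentiable (by norm_num) _)]
    simp only [add_apply, smul_apply, hfd, smul_eq_mul,
      emb_apply_last]
    simp only [hfdef]
    ring

/-- The weighted integrals of `F ∘ σ` against an integrable `A` are integrable as soon as `σ` stays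
in a compact subset of `(0, ∞)` where `A` does not vanish. -/
theorem integrable_comp_mul {Y : Type*} [MeasurableSpace Y] {μ : Measure Y} {F : ℝ → ℝ}
    (hF : Measurable F) (hFc : ContinuousOn F (Set.Ioi 0)) {A σ : Y → ℝ} (hA : Integrable A μ)
    (hσ : Measurable σ) {m M : ℝ} (hm : 0 < m) (h : ∀ y, A y ≠ 0 → σ y ∈ Set.Icc m M) :
    Integrable (fun y => F (σ y) * A y) μ := by
  obtain ⟨C, hC⟩ := isCompact_Icc.exists_bound_of_continuousOn
    (hFc.mono fun s (hs : s ∈ Set.Icc m M) => lt_of_lt_of_le hm hs.1)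
  refine (hA.norm.const_mul C).mono' ((hF.comp hσ).aestronglyMeasurable.mul hA.1)
    (Filter.Eventually.of_forall fun y => ?_)
  by_cases hy : A y = 0
  · simp [hy]
  · rw [norm_mul]
    exact mul_le_mul_of_nonneg_right (hC _ (h y hy)) (norm_nonneg _)

theorem tendsto_integral_comp_add {Y : Type*} [MeasurableSpace Y] {μ : Measure Y} {F : ℝ → ℝ}
    (hF : Measurable F) (hFc : ContinuousOn F (Set.Ioi 0)) {A σ : Y → ℝ} (hA : Integrable A μ)
    (hσ : Measurable σ) {m M : ℝ} (hm : 0 < m) (h : ∀ y, A y ≠ 0 → σ y ∈ Set.Icc m M) :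
    Filter.Tendsto (fun k : ℝ => ∫ y, F (σ y + (k ^ 2)⁻¹) * A y ∂μ) Filter.atTop
      (nhds (∫ y, F (σ y) * A y ∂μ)) := by
  obtain ⟨C, hC⟩ := isCompact_Icc.exists_bound_of_continuousOn
    (hFc.mono fun s (hs : s ∈ Set.Icc m (M + 1)) => lt_of_lt_of_le hm hs.1)
  have hk0 : Filter.Tendsto (fun k : ℝ => (k ^ 2)⁻¹) Filter.atTop (nhds 0) :=
    (Filter.tendsto_pow_atTop two_ne_zero).inv_tendsto_atTop
  refine tendsto_integral_filter_of_dominated_convergence (fun y => C * ‖A y‖) ?_ ?_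
    (hA.norm.const_mul C) ?_
  · exact Filter.Eventually.of_forall fun k =>
      (hF.comp (hσ.add_const _)).aestronglyMeasurable.mul hA.1
  · filter_upwards [Filter.eventually_ge_atTop 1] with k hk
    refine Filter.Eventually.of_forall fun y => ?_
    by_cases hy : A y = 0
    · simp [hy]
    · rw [norm_mul]
      have h1 : (k ^ 2)⁻¹ ≤ 1 := inv_le_one_of_one_le₀ (one_le_pow₀ hk)
      have h2 : 0 ≤ (k ^ 2)⁻¹ := by positivity
      have h3 := h y hy
      exact mul_le_mul_of_nonneg_right
        (hC _ ⟨by linarith [h3.1], by linarith [h3.2]⟩) (norm_nonneg _)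
  · refine Filter.Eventually.of_forall fun y => ?_
    by_cases hy : A y = 0
    · simp [hy]
    · refine Filter.Tendsto.mul_const _ ?_
      have h4 : ContinuousAt F (σ y) :=
        hFc.continuousAt (Ioi_mem_nhds (lt_of_lt_of_le hm (h y hy).1))
      refine h4.tendsto.comp ?_
      simpa using hk0.const_add (σ y)

theorem measurable_radialKernel (n : ℕ) : Measurable (radialKernel n) := by
  unfold radialKernel; fun_prop

theorem measurable_radialPotential (n : ℕ) : Measurable (radialPotential n) := by
  unfold radialPotential
  split_ifs <;> fun_prop

theorem continuousOn_radialKernel (n : ℕ) : ContinuousOn (radialKernel n) (Set.Ioi 0) :=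
  fun _ hs => (hasDerivAt_radialKernel n hs).continuousAt.continuousWithinAt

theorem continuousOn_radialPotential (n : ℕ) : ContinuousOn (radialPotential n) (Set.Ioi 0) :=
  fun _ hs => (hasDerivAt_radialPotential n hs).continuousAt.continuousWithinAt

theorem integrableOn_upperHalf {n : ℕ} {f : Euc (n + 1) → ℝ} (hf : ContinuousOn f (closedHalf n))
    {r : ℝ} (h0 : ∀ y, r < ‖y‖ → f y = 0) : IntegrableOn f (upperHalf n) := by
  have hc : IsCompact (closedHalf n ∩ Metric.closedBall 0 r) :=
    (isCompact_closedBall _ _).inter_left (isClosed_closedHalf n)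
  have h1 : IntegrableOn f (closedHalf n ∩ Metric.closedBall 0 r) :=
    (hf.mono Set.inter_subset_left).integrableOn_compact hc
  refine IntegrableOn.of_forall_sdiff_eq_zero h1 (isOpen_upperHalf n).measurableSet ?_
  rintro y ⟨hy1, hy2⟩
  refine h0 y ?_
  by_contra hcon
  push Not at hcon
  exact hy2 ⟨upperHalf_subset_closedHalf n hy1, by simpa using hcon⟩

theorem integrable_of_continuous_of_bounded_support {n : ℕ} {f : Euc n → ℝ} (hf : Continuous f)
    {r : ℝ} (h0 : ∀ y, r < ‖y‖ → f y = 0) : Integrable f := by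
  refine hf.integrable_of_hasCompactSupport ?_
  refine HasCompactSupport.intro (isCompact_closedBall 0 r) fun y hy => h0 y ?_
  simpa using hy

/-- The total mass of the approximate identity produced by the regularized potential. -/
noncomputable def potentialMass (n : ℕ) : ℝ :=
  ∫ y : Euc (n + 1), (1 + ‖y‖ ^ 2) ^ (-((n : ℝ) + 1 + 2) / 2)

theorem integrable_potentialMass (n : ℕ) :
    Integrable fun y : Euc (n + 1) => (1 + ‖y‖ ^ 2) ^ (-((n : ℝ) + 1 + 2) / 2) := by
  refine integrable_rpow_neg_one_add_norm_sq ?_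
  simp

theorem potentialMass_pos (n : ℕ) : 0 < potentialMass n := by
  refine (integral_pos_iff_support_of_nonneg (fun y => by positivity)
    (integrable_potentialMass n)).2 ?_
  have : Function.support (fun y : Euc (n + 1) => (1 + ‖y‖ ^ 2) ^ (-((n : ℝ) + 1 + 2) / 2)) =
      Set.univ := by
    ext y
    simp only [Function.mem_support, Set.mem_univ, iff_true]
    positivity
  rw [this]
  simp

theorem tendsto_potentialMass {n : ℕ} {g : Euc (n + 1) → ℝ} {x : Euc (n + 1)}
    (hg : Integrable g) (hgx : ContinuousAt g x) :
    Filter.Tendsto (fun k : ℝ => ∫ y, g y *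
        (2 * (n + 1) * (k ^ 2)⁻¹ * (‖y - x‖ ^ 2 + (k ^ 2)⁻¹) ^ (-((n : ℝ) + 1) / 2 - 1)))
      Filter.atTop (nhds (2 * (n + 1) * potentialMass n * g x)) := by
  have hκ := potentialMass_pos n
  set φ : Euc (n + 1) → ℝ := fun y =>
    (potentialMass n)⁻¹ * (1 + ‖y‖ ^ 2) ^ (-((n : ℝ) + 1 + 2) / 2) with hφ
  have h1 : ∫ y, φ y = 1 := by
    rw [hφ, integral_const_mul]
    exact inv_mul_cancel₀ hκ.ne'
  have h2 : Filter.Tendsto (fun y => ‖y‖ ^ Module.finrank ℝ (Euc (n + 1)) * φ y)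
      (Bornology.cobounded _) (nhds 0) := by
    have h3 : Filter.Tendsto (fun y : Euc (n + 1) => (potentialMass n)⁻¹ * (1 + ‖y‖ ^ 2)⁻¹)
        (Bornology.cobounded _) (nhds 0) := by
      have : Filter.Tendsto (fun y : Euc (n + 1) => 1 + ‖y‖ ^ 2) (Bornology.cobounded _)
          Filter.atTop :=
        Filter.tendsto_atTop_add_const_left _ _
          ((Filter.tendsto_pow_atTop two_ne_zero).comp tendsto_norm_cobounded_atTop)
      simpa using this.inv_tendsto_atTop.const_mul (potentialMass n)⁻¹
    refine squeeze_zero (fun y => by positivity) (fun y => ?_) h3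
    have h4 : (0 : ℝ) < 1 + ‖y‖ ^ 2 := by positivity
    have h5 : ‖y‖ ^ (n + 1) ≤ (1 + ‖y‖ ^ 2) ^ (((n : ℝ) + 1) / 2) := by
      calc ‖y‖ ^ (n + 1) = (‖y‖ ^ 2) ^ (((n : ℝ) + 1) / 2) := by
            rw [← Real.rpow_natCast, ← Real.rpow_natCast, ← Real.rpow_mul (norm_nonneg _)]
            congr 1; push_cast; ring
        _ ≤ _ := Real.rpow_le_rpow (by positivity) (by linarith) (by positivity)
    have h6 : (1 + ‖y‖ ^ 2) ^ (-((n : ℝ) + 1 + 2) / 2) =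
        ((1 + ‖y‖ ^ 2) ^ (((n : ℝ) + 1) / 2))⁻¹ * (1 + ‖y‖ ^ 2)⁻¹ := by
      rw [← Real.rpow_neg h4.le, ← Real.rpow_neg_one, ← Real.rpow_add h4]
      congr 1; ring
    have h7 : (0 : ℝ) < (1 + ‖y‖ ^ 2) ^ (((n : ℝ) + 1) / 2) := Real.rpow_pos_of_pos h4 _
    rw [finrank_euclideanSpace, Fintype.card_fin, hφ]
    simp only
    rw [h6]
    calc _ = (potentialMass n)⁻¹ * (‖y‖ ^ (n + 1) / (1 + ‖y‖ ^ 2) ^ (((n : ℝ) + 1) / 2) *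
          (1 + ‖y‖ ^ 2)⁻¹) := by ring
      _ ≤ (potentialMass n)⁻¹ * (1 * (1 + ‖y‖ ^ 2)⁻¹) := by
          gcongr
          exact (div_le_one h7).2 h5
      _ = _ := by ring
  have key := (tendsto_integral_comp_smul_smul_of_integrable' (fun y => by positivity) h1 h2
    hg hgx).const_mul (2 * (n + 1) * potentialMass n)
  refine key.congr' ?_
  filter_upwards [Filter.eventually_gt_atTop 0] with k hk
  rw [← integral_const_mul]
  refine integral_congr_ae (Filter.Eventually.of_forall fun y => ?_)
  simp only [hφ, smul_eq_mul, finrank_euclideanSpace, Fintype.card_fin]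
  have h8 : 1 + ‖k • (x - y)‖ ^ 2 = k ^ 2 * (‖y - x‖ ^ 2 + (k ^ 2)⁻¹) := by
    rw [norm_smul, mul_pow, Real.norm_eq_abs, sq_abs, norm_sub_rev]
    field_simp
    ring
  have h9 : (k ^ 2) ^ (-((n : ℝ) + 1 + 2) / 2) = (k ^ (n + 1))⁻¹ * (k ^ 2)⁻¹ := by
    rw [← Real.rpow_natCast, ← Real.rpow_mul hk.le, ← Real.rpow_natCast, ← Real.rpow_neg hk.le,
      ← Real.rpow_neg hk.le, ← Real.rpow_add hk]
    congr 1; push_cast; ring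
  rw [h8, Real.mul_rpow (by positivity) (by positivity), h9,
    show -((n : ℝ) + 1 + 2) / 2 = -((n : ℝ) + 1) / 2 - 1 by ring]
  field_simp

/-- A `C²` function equal to `1` on the ball of radius `8` and supported in the ball of
radius `16`. -/
structure IsCutoff {m : ℕ} (χ : Euc m → ℝ) : Prop where
  contDiff : ContDiff ℝ 2 χ
  tsupport_subset : tsupport χ ⊆ Metric.closedBall 0 16
  eq_one : ∀ y, ‖y‖ < 8 → χ y = 1

theorem exists_isCutoff (m : ℕ) : ∃ χ : Euc m → ℝ, IsCutoff χ := by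
  let b : ContDiffBump (0 : Euc m) := ⟨8, 16, by norm_num, by norm_num⟩
  refine ⟨b, b.contDiff, b.tsupport_eq.subset, fun y hy => b.one_of_mem_closedBall ?_⟩
  simpa using hy.le

namespace IsCutoff

variable {m : ℕ} {χ : Euc m → ℝ}

theorem eventuallyEq (h : IsCutoff χ) {y : Euc m} (hy : ‖y‖ < 8 ∨ 16 < ‖y‖) :
    ∃ c : ℝ, χ =ᶠ[nhds y] fun _ => c := by
  rcases hy with hy | hy
  · refine ⟨1, ?_⟩
    filter_upwards [continuous_norm.continuousAt.eventually_lt_const hy] with z hz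
    exact h.eq_one z hz
  · refine ⟨0, notMem_tsupport_iff_eventuallyEq.mp fun h1 => ?_⟩
    have := h.tsupport_subset h1
    simp at this
    linarith

theorem fderiv_eq_zero (h : IsCutoff χ) {y : Euc m} (hy : ‖y‖ < 8 ∨ 16 < ‖y‖) :
    fderiv ℝ χ y = 0 := by
  obtain ⟨c, hc⟩ := h.eventuallyEq hy
  rw [hc.fderiv_eq]; simp

theorem lapl_eq_zero (h : IsCutoff χ) {y : Euc m} (hy : ‖y‖ < 8 ∨ 16 < ‖y‖) :
    lapl χ y = 0 := by
  obtain ⟨c, hc⟩ := h.eventuallyEq hy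
  unfold lapl
  refine Finset.sum_eq_zero fun i _ => ?_
  have : (fun z => fderiv ℝ χ z (EuclideanSpace.single i 1)) =ᶠ[nhds y] fun _ => 0 := by
    filter_upwards [hc.eventuallyEq_nhds] with z hz
    rw [hz.fderiv_eq]; simp
  rw [this.fderiv_eq]; simp

theorem eq_zero (h : IsCutoff χ) {y : Euc m} (hy : 16 < ‖y‖) : χ y = 0 := by
  refine image_eq_zero_of_notMem_tsupport fun h1 => ?_
  have := h.tsupport_subset h1
  simp at this
  linarith

theorem continuous_fderiv (h : IsCutoff χ) : Continuous (fderiv ℝ χ) :=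
  h.contDiff.continuous_fderiv (by norm_num)

theorem continuous_lapl (h : IsCutoff χ) : Continuous (lapl χ) := by
  unfold lapl
  refine continuous_finsetSum _ fun i _ => ?_
  have h1 : ContDiff ℝ 1 (fun y => fderiv ℝ χ y (EuclideanSpace.single i 1)) :=
    (h.contDiff.fderiv_right (by norm_num)).clm_apply contDiff_const
  exact (h1.continuous_fderiv (by norm_num)).clm_apply continuous_const

end IsCutoff

/-- The derivative of `χ` at `y` in the direction `y - x`. -/
noncomputable def radialDeriv {m : ℕ} (χ : Euc m → ℝ) (x y : Euc m) : ℝ :=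
  ∑ i, fderiv ℝ χ y (EuclideanSpace.single i 1) * (y i - x i)

theorem IsCutoff.continuous_radialDeriv {m : ℕ} {χ : Euc m → ℝ} (h : IsCutoff χ) (x : Euc m) :
    Continuous (radialDeriv χ x) := by
  unfold radialDeriv
  refine continuous_finsetSum _ fun i _ => ?_
  exact (h.continuous_fderiv.clm_apply continuous_const).mul
    ((continuous_coord i).sub continuous_const)

theorem IsCutoff.radialDeriv_eq_zero {m : ℕ} {χ : Euc m → ℝ} (h : IsCutoff χ) {x y : Euc m}
    (hy : ‖y‖ < 8 ∨ 16 < ‖y‖) : radialDeriv χ x y = 0 := by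
  simp [radialDeriv, h.fderiv_eq_zero hy]

/-- The normal derivative of `u` on the boundary hyperplane. -/
noncomputable def normalDeriv {n : ℕ} (u : Euc (n + 1) → ℝ) (y' : Euc n) : ℝ :=
  fderivWithin ℝ u (closedHalf n) (emb y') (EuclideanSpace.single (Fin.last n) 1)

/-- The density of the single layer potential in the local representation formula. -/
noncomputable def singleDensity {n : ℕ} (χ u : Euc (n + 1) → ℝ) (y' : Euc n) : ℝ :=
  χ (emb y') * normalDeriv u y'
    - u (emb y') * fderiv ℝ χ (emb y') (EuclideanSpace.single (Fin.last n) 1)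

/-- The density of the double layer potential in the local representation formula. -/
noncomputable def doubleDensity {n : ℕ} (χ u : Euc (n + 1) → ℝ) (y' : Euc n) : ℝ :=
  χ (emb y') * u (emb y')

theorem norm_emb {n : ℕ} (x : Euc n) : ‖emb x‖ = ‖x‖ := by
  rw [EuclideanSpace.norm_eq, EuclideanSpace.norm_eq, Fin.sum_univ_castSucc]
  simp [emb_apply_last, emb_apply_castSucc]

theorem continuous_trace {n : ℕ} {u : Euc (n + 1) → ℝ} (hu : ContDiffOn ℝ 1 u (closedHalf n)) :
    Continuous fun y' => u (emb y') :=
  hu.continuousOn.comp_continuous (continuous_emb n) emb_mem_closedHalf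

theorem continuous_normalDeriv {n : ℕ} {u : Euc (n + 1) → ℝ}
    (hu : ContDiffOn ℝ 1 u (closedHalf n)) : Continuous (normalDeriv u) :=
  ((hu.continuousOn_fderivWithin (uniqueDiffOn_closedHalf n) le_rfl).comp_continuous
    (continuous_emb n) emb_mem_closedHalf).clm_apply continuous_const

theorem IsCutoff.continuous_singleDensity {n : ℕ} {χ u : Euc (n + 1) → ℝ} (h : IsCutoff χ)
    (hu : ContDiffOn ℝ 1 u (closedHalf n)) : Continuous (singleDensity χ u) :=
  ((h.contDiff.continuous.comp (continuous_emb n)).mul (continuous_normalDeriv hu)).sub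
    ((continuous_trace hu).mul
      ((h.continuous_fderiv.comp (continuous_emb n)).clm_apply continuous_const))

theorem IsCutoff.continuous_doubleDensity {n : ℕ} {χ u : Euc (n + 1) → ℝ} (h : IsCutoff χ)
    (hu : ContDiffOn ℝ 1 u (closedHalf n)) : Continuous (doubleDensity χ u) :=
  (h.contDiff.continuous.comp (continuous_emb n)).mul (continuous_trace hu)

theorem IsCutoff.singleDensity_eq_zero {n : ℕ} {χ u : Euc (n + 1) → ℝ} (h : IsCutoff χ)
    {y' : Euc n} (hy : 16 < ‖y'‖) : singleDensity χ u y' = 0 := by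
  rw [← norm_emb] at hy
  simp [singleDensity, h.eq_zero hy, h.fderiv_eq_zero (Or.inr hy)]

theorem IsCutoff.doubleDensity_eq_zero {n : ℕ} {χ u : Euc (n + 1) → ℝ} (h : IsCutoff χ)
    {y' : Euc n} (hy : 16 < ‖y'‖) : doubleDensity χ u y' = 0 := by
  rw [← norm_emb] at hy
  simp [doubleDensity, h.eq_zero hy]

/-- Local representation formula: a harmonic function in the half-space is, up to a potential
generated away from the point, the sum of a single and a double layer potential of its Cauchy
data; below the boundary hyperplane the same expression vanishes. -/
theorem representation_formula {n : ℕ} {χ u : Euc (n + 1) → ℝ} (hχ : IsCutoff χ)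
    (hu : ContDiffOn ℝ 1 u (closedHalf n)) (hh : HarmonicOnSet u (upperHalf n))
    {x : Euc (n + 1)} (hx : ‖x‖ ≤ 4) (hxn : x (Fin.last n) ≠ 0) :
    2 * (n + 1) * potentialMass n * (upperHalf n).indicator u x +
      ((∫ y in upperHalf n, radialKernel n (‖y - x‖ ^ 2) * (4 * u y * radialDeriv χ x y)) +
        ∫ y in upperHalf n, radialPotential n (‖y - x‖ ^ 2) * (u y * lapl χ y)) =
      (∫ y' : Euc n, radialPotential n (‖emb y' - x‖ ^ 2) * singleDensity χ u y') +
        ∫ y' : Euc n, radialKernel n (‖emb y' - x‖ ^ 2) *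
          (2 * x (Fin.last n) * doubleDensity χ u y') := by
  have hA1 : IntegrableOn (fun y => 4 * u y * radialDeriv χ x y) (upperHalf n) :=
    integrableOn_upperHalf (r := 16)
      ((continuousOn_const.mul hu.continuousOn).mul (hχ.continuous_radialDeriv x).continuousOn)
      fun y hy => by rw [hχ.radialDeriv_eq_zero (Or.inr hy), mul_zero]
  have hA2 : IntegrableOn (fun y => u y * lapl χ y) (upperHalf n) :=
    integrableOn_upperHalf (r := 16) (hu.continuousOn.mul hχ.continuous_lapl.continuousOn)
      fun y hy => by rw [hχ.lapl_eq_zero (Or.inr hy), mul_zero]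
  have hA0 : IntegrableOn (fun y => χ y * u y) (upperHalf n) :=
    integrableOn_upperHalf (r := 16) (hχ.contDiff.continuous.continuousOn.mul hu.continuousOn)
      fun y hy => by rw [hχ.eq_zero hy, zero_mul]
  have hB1 : Integrable (singleDensity χ u) :=
    integrable_of_continuous_of_bounded_support (hχ.continuous_singleDensity hu)
      fun y hy => hχ.singleDensity_eq_zero hy
  have hB2 : Integrable (fun y' => 2 * x (Fin.last n) * doubleDensity χ u y') :=
    (integrable_of_continuous_of_bounded_support (hχ.continuous_doubleDensity hu)
      fun y hy => hχ.doubleDensity_eq_zero hy).const_mul _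
  have hσ : Measurable fun y : Euc (n + 1) => ‖y - x‖ ^ 2 := by fun_prop
  have hσ' : Measurable fun y' : Euc n => ‖emb y' - x‖ ^ 2 := by
    have := (continuous_emb n).measurable
    fun_prop
  have hsupp : ∀ y : Euc (n + 1), ¬(‖y‖ < 8 ∨ 16 < ‖y‖) →
      ‖y - x‖ ^ 2 ∈ Set.Icc (16 : ℝ) 400 := by
    intro y hy
    push Not at hy
    have h1 := norm_sub_le y x
    have h2 := norm_sub_norm_le y x
    have h3 := norm_nonneg (y - x)
    constructor <;> nlinarith
  have hs1 : ∀ y, 4 * u y * radialDeriv χ x y ≠ 0 → ‖y - x‖ ^ 2 ∈ Set.Icc (16 : ℝ) 400 :=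
    fun y hy => hsupp y fun h => hy (by rw [hχ.radialDeriv_eq_zero h, mul_zero])
  have hs2 : ∀ y, u y * lapl χ y ≠ 0 → ‖y - x‖ ^ 2 ∈ Set.Icc (16 : ℝ) 400 :=
    fun y hy => hsupp y fun h => hy (by rw [hχ.lapl_eq_zero h, mul_zero])
  have hsupp' : ∀ y' : Euc n, ‖y'‖ ≤ 16 →
      ‖emb y' - x‖ ^ 2 ∈ Set.Icc (x (Fin.last n) ^ 2) 400 := by
    intro y' hy
    have h1 := norm_sub_le (emb y') x
    rw [norm_emb] at h1
    have h3 := norm_nonneg (emb y' - x)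
    refine ⟨?_, by nlinarith⟩
    have h4 := PiLp.norm_apply_le (emb y' - x) (Fin.last n)
    rw [PiLp.sub_apply, emb_apply_last, zero_sub, norm_neg, Real.norm_eq_abs] at h4
    rw [← sq_abs]
    exact pow_le_pow_left₀ (abs_nonneg _) h4 2
  have hs3 : ∀ y', singleDensity χ u y' ≠ 0 →
      ‖emb y' - x‖ ^ 2 ∈ Set.Icc (x (Fin.last n) ^ 2) 400 := fun y' hy =>
    hsupp' y' (not_lt.1 fun h => hy (hχ.singleDensity_eq_zero h))
  have hs4 : ∀ y', 2 * x (Fin.last n) * doubleDensity χ u y' ≠ 0 →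
      ‖emb y' - x‖ ^ 2 ∈ Set.Icc (x (Fin.last n) ^ 2) 400 := fun y' hy =>
    hsupp' y' (not_lt.1 fun h => hy (by rw [hχ.doubleDensity_eq_zero h, mul_zero]))
  have hxn2 : 0 < x (Fin.last n) ^ 2 := by positivity
  have mK := measurable_radialKernel n
  have mP := measurable_radialPotential n
  have cK := continuousOn_radialKernel n
  have cP := continuousOn_radialPotential n
  have h16 : (0 : ℝ) < 16 := by norm_num
  have l1 := tendsto_integral_comp_add mK cK hA1 hσ h16 hs1
  have l2 := tendsto_integral_comp_add mP cP hA2 hσ h16 hs2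
  have l3 := tendsto_integral_comp_add mP cP hB1 hσ' hxn2 hs3
  have l4 := tendsto_integral_comp_add mK cK hB2 hσ' hxn2 hs4
  have hopen := isOpen_upperHalf n
  set g : Euc (n + 1) → ℝ := (upperHalf n).indicator fun y => χ y * u y with hg
  have hgi : Integrable g := hA0.integrable_indicator hopen.measurableSet
  have hgc : ContinuousAt g x := by
    rcases lt_or_gt_of_ne hxn with hneg | hpos
    · have : g =ᶠ[nhds x] fun _ => 0 := by
        filter_upwards [(continuous_coord (Fin.last n)).continuousAt.eventually_lt_const hneg]
          with z hz
        have hz' : z ∉ upperHalf n := fun h => by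
          have : 0 < z (Fin.last n) := h
          linarith
        exact Set.indicator_of_notMem hz' _
      exact continuousAt_const.congr this.symm
    · have : g =ᶠ[nhds x] fun y => χ y * u y := by
        filter_upwards [hopen.mem_nhds hpos] with z hz
        exact Set.indicator_of_mem hz _
      refine ContinuousAt.congr ?_ this.symm
      exact hχ.contDiff.continuous.continuousAt.mul
        (hu.continuousOn.continuousAt (closedHalf_mem_nhds hpos))
  have hgx : g x = (upperHalf n).indicator u x := by
    simp only [hg, Set.indicator]
    rw [hχ.eq_one x (by linarith), one_mul]
  have l0 := tendsto_potentialMass hgi hgc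
  rw [hgx] at l0
  refine tendsto_nhds_unique ((l0.add (l1.add l2)).congr' ?_) (l3.add l4)
  filter_upwards [Filter.eventually_gt_atTop 0] with k hk
  have hδ : 0 < (k ^ 2)⁻¹ := by positivity
  have key := green_regularized hu hh hχ.contDiff (by norm_num) hχ.tsupport_subset x hδ
  have hk1 : ∀ {s : ℝ} {m M : ℝ}, s ∈ Set.Icc m M →
      s + (k ^ 2)⁻¹ ∈ Set.Icc m (M + (k ^ 2)⁻¹) := fun h =>
    ⟨by linarith [h.1], by linarith [h.2]⟩
  have i1 := integrable_comp_mul mK cK hA1 (hσ.add_const (k ^ 2)⁻¹) h16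
    fun y hy => hk1 (hs1 y hy)
  have i2 := integrable_comp_mul mP cP hA2 (hσ.add_const (k ^ 2)⁻¹) h16
    fun y hy => hk1 (hs2 y hy)
  have i3 := integrable_comp_mul mP cP hB1 (hσ'.add_const (k ^ 2)⁻¹) hxn2
    fun y hy => hk1 (hs3 y hy)
  have i4 := integrable_comp_mul mK cK hB2 (hσ'.add_const (k ^ 2)⁻¹) hxn2
    fun y hy => hk1 (hs4 y hy)
  have i0 : IntegrableOn (fun y => χ y * u y * (2 * (n + 1) * (k ^ 2)⁻¹ *
      (‖y - x‖ ^ 2 + (k ^ 2)⁻¹) ^ (-((n : ℝ) + 1) / 2 - 1))) (upperHalf n) := by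
    refine integrableOn_upperHalf (r := 16) ?_ fun y hy => by rw [hχ.eq_zero hy]; ring
    refine (hχ.contDiff.continuous.continuousOn.mul hu.continuousOn).mul
      (continuousOn_const.mul (Continuous.continuousOn ?_))
    refine Continuous.rpow_const (by fun_prop) fun y => Or.inl ?_
    positivity
  have e0 : ∫ y, g y * (2 * (n + 1) * (k ^ 2)⁻¹ *
      (‖y - x‖ ^ 2 + (k ^ 2)⁻¹) ^ (-((n : ℝ) + 1) / 2 - 1)) =
      ∫ y in upperHalf n, χ y * u y * (2 * (n + 1) * (k ^ 2)⁻¹ *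
      (‖y - x‖ ^ 2 + (k ^ 2)⁻¹) ^ (-((n : ℝ) + 1) / 2 - 1)) := by
    rw [← integral_indicator hopen.measurableSet]
    refine integral_congr_ae (Filter.Eventually.of_forall fun y => ?_)
    simp only [hg, Set.indicator]
    split_ifs <;> simp
  have e1 := integral_add i0 (i1.add i2)
  simp only [Pi.add_apply] at e1
  rw [e0, ← integral_add i1 i2, ← e1, ← integral_add i3 i4]
  refine Eq.trans ?_ (key.trans rfl)
  refine integral_congr_ae (Filter.Eventually.of_forall fun y => ?_)
  simp only [radialDeriv]
  exact (add_assoc _ _ _).symm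

theorem isCompact_re_norm (m M : ℝ) : IsCompact {z : ℂ | m ≤ z.re ∧ ‖z‖ ≤ M} := by
  refine (isCompact_closedBall (0 : ℂ) M).of_isClosed_subset ?_ fun z hz => by
    simpa using hz.2
  exact (isClosed_le continuous_const Complex.continuous_re).inter
    (isClosed_le continuous_norm continuous_const)

theorem exists_norm_le_of_differentiableOn_re_pos {K : ℂ → ℂ}
    (hK : DifferentiableOn ℂ K {z | 0 < z.re}) {m : ℝ} (hm : 0 < m) (M : ℝ) :
    ∃ C, 0 ≤ C ∧ ∀ z : ℂ, m ≤ z.re → ‖z‖ ≤ M → ‖K z‖ ≤ C := by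
  obtain ⟨C, hC⟩ := (isCompact_re_norm m M).exists_bound_of_continuousOn
    (hK.continuousOn.mono fun z hz => lt_of_lt_of_le hm hz.1)
  exact ⟨|C|, abs_nonneg C, fun z h1 h2 => (hC z ⟨h1, h2⟩).trans (le_abs_self C)⟩

theorem norm_integral_comp_mul_le {Y : Type*} [MeasurableSpace Y] {μ : Measure Y} {K : ℂ → ℂ}
    {A : Y → ℝ} (hA : Integrable A μ) {s : Y → ℂ} {C : ℝ}
    (h : ∀ y, A y ≠ 0 → ‖K (s y)‖ ≤ C) :
    ‖∫ y, K (s y) * (A y : ℂ) ∂μ‖ ≤ C * ∫ y, |A y| ∂μ := by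
  rw [← integral_const_mul]
  refine norm_integral_le_of_norm_le (hA.norm.const_mul C)
    (Filter.Eventually.of_forall fun y => ?_)
  by_cases hy : A y = 0
  · simp [hy]
  · rw [norm_mul, Complex.norm_real]
    exact mul_le_mul_of_nonneg_right (h y hy) (norm_nonneg _)

theorem differentiableOn_integral_comp_mul {Y : Type*} [MeasurableSpace Y] {μ : Measure Y}
    {K : ℂ → ℂ} (hK : DifferentiableOn ℂ K {z | 0 < z.re}) (hKm : Measurable K)
    {A : Y → ℝ} (hA : Integrable A μ) {p q : Y → ℝ} (hp : Measurable p) (hq : Measurable q)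
    {U : Set ℂ} (hU : IsOpen U) {m M Q T : ℝ} (hm : 0 < m) (hT : ∀ t ∈ U, ‖t‖ ≤ T)
    (h : ∀ t ∈ U, ∀ y, A y ≠ 0 →
      m ≤ (t ^ 2 - 2 * t * q y + p y).re ∧ ‖t ^ 2 - 2 * t * q y + p y‖ ≤ M)
    (hQ : ∀ y, A y ≠ 0 → |q y| ≤ Q) :
    DifferentiableOn ℂ (fun t => ∫ y, K (t ^ 2 - 2 * t * q y + p y) * (A y : ℂ) ∂μ) U := by
  have hopen : IsOpen {z : ℂ | 0 < z.re} := isOpen_lt continuous_const Complex.continuous_re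
  obtain ⟨C, hC0, hC⟩ := exists_norm_le_of_differentiableOn_re_pos hK hm M
  obtain ⟨C', hC0', hC'⟩ := exists_norm_le_of_differentiableOn_re_pos (hK.deriv hopen) hm M
  intro t₀ ht₀
  have hsm : ∀ t : ℂ, Measurable fun y => t ^ 2 - 2 * t * (q y : ℂ) + (p y : ℂ) := fun t => by
    fun_prop
  have hAm : AEStronglyMeasurable (fun y => (A y : ℂ)) μ :=
    Complex.continuous_ofReal.comp_aestronglyMeasurable hA.1
  have key := hasDerivAt_integral_of_dominated_loc_of_deriv_le (μ := μ) (𝕜 := ℂ)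
    (F := fun t y => K (t ^ 2 - 2 * t * q y + p y) * (A y : ℂ))
    (F' := fun t y => deriv K (t ^ 2 - 2 * t * q y + p y) * (2 * t - 2 * q y) * (A y : ℂ))
    (x₀ := t₀) (s := U) (bound := fun y => C' * (2 * T + 2 * Q) * |A y|)
    (hU.mem_nhds ht₀)
    (Filter.Eventually.of_forall fun t => ((hKm.comp (hsm t)).aestronglyMeasurable.mul hAm))
    ?_ ?_ ?_ ?_ ?_
  · exact key.2.differentiableAt.differentiableWithinAt
  · refine (hA.norm.const_mul C).mono' ((hKm.comp (hsm t₀)).aestronglyMeasurable.mul hAm)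
      (Filter.Eventually.of_forall fun y => ?_)
    by_cases hy : A y = 0
    · simp [hy]
    · rw [norm_mul, Complex.norm_real]
      obtain ⟨h1, h2⟩ := h t₀ ht₀ y hy
      exact mul_le_mul_of_nonneg_right (hC _ h1 h2) (norm_nonneg _)
  · refine AEStronglyMeasurable.mul (Measurable.aestronglyMeasurable ?_) hAm
    refine ((measurable_deriv K).comp (hsm t₀)).mul ?_
    fun_prop
  · refine Filter.Eventually.of_forall fun y t ht => ?_
    by_cases hy : A y = 0
    · simp [hy]
    · obtain ⟨h1, h2⟩ := h t ht y hy
      have h3 : ‖(2 * t - 2 * q y : ℂ)‖ ≤ 2 * T + 2 * Q := by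
        refine (norm_sub_le _ _).trans ?_
        rw [norm_mul, norm_mul, Complex.norm_real]
        have := hT t ht
        have := hQ y hy
        simp only [Complex.norm_ofNat, Real.norm_eq_abs]
        linarith
      rw [norm_mul, norm_mul, Complex.norm_real]
      exact mul_le_mul_of_nonneg_right
        (mul_le_mul (hC' _ h1 h2) h3 (norm_nonneg _) hC0') (norm_nonneg _)
  · exact hA.norm.const_mul _
  · refine Filter.Eventually.of_forall fun y t ht => ?_
    by_cases hy : A y = 0
    · simpa [hy] using hasDerivAt_const t (0 : ℂ)
    · obtain ⟨h1, h2⟩ := h t ht y hy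
      have h4 : t ^ 2 - 2 * t * (q y : ℂ) + p y ∈ {z : ℂ | 0 < z.re} :=
        show (0 : ℝ) < (t ^ 2 - 2 * t * (q y : ℂ) + p y).re from hm.trans_le h1
      have hd : HasDerivAt K (deriv K (t ^ 2 - 2 * t * q y + p y)) (t ^ 2 - 2 * t * q y + p y) :=
        ((hK _ h4).differentiableAt (hopen.mem_nhds h4)).hasDerivAt
      have hs : HasDerivAt (fun t : ℂ => t ^ 2 - 2 * t * q y + p y) (2 * t - 2 * q y) t := by
        have := (((hasDerivAt_id t).pow 2).sub
          (((hasDerivAt_id t).const_mul (2 : ℂ)).mul_const (q y : ℂ))).add_const (p y : ℂ)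
        refine this.congr_deriv ?_
        simp
      exact (hd.comp t hs).mul_const _

/-- A three-circle type estimate for a holomorphic function, with a fixed interpolation exponent. -/
theorem exists_norm_le_rpow_mul_rpow : ∃ C : ℝ, 0 ≤ C ∧ ∀ (W F : ℂ → ℂ) (c : ℝ) (U : Set ℂ)
    (M E : ℝ), IsOpen U → Metric.closedBall (c : ℂ) (3 / 2) ⊆ U → DifferentiableOn ℂ W U →
    DifferentiableOn ℂ F (Metric.ball (c : ℂ) (1 / 8)) → (∀ z ∈ U, ‖W z‖ ≤ M) →
    (∀ z ∈ Metric.ball (c : ℂ) (1 / 8), ‖F z‖ ≤ E) →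
    (∀ t : ℝ, |t - c| < 1 / 8 → W t = F t) →
    ∀ z ∈ Metric.closedBall (c : ℂ) 1, ‖W z‖ ≤ C * M ^ (9 / 10 : ℝ) * E ^ (1 / 10 : ℝ) := by
  set θ : ℝ := (2 / 3) ^ (9 / 10 : ℝ) * 9 ^ (1 / 10 : ℝ) with hθ
  have hθ0 : 0 ≤ θ := by positivity
  have hθ1 : θ < 1 := by
    have h : θ ^ 10 < 1 := by
      rw [hθ, mul_pow, ← Real.rpow_natCast, ← Real.rpow_natCast, ← Real.rpow_mul (by norm_num),
        ← Real.rpow_mul (by norm_num)]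
      norm_num
    by_contra! h'
    exact absurd h (not_lt.2 (one_le_pow₀ h'))
  refine ⟨(1 - θ)⁻¹, inv_nonneg.2 (by linarith), ?_⟩
  intro W F c U M E hU hcU hW hF hM hE heq z hz
  have hball : Metric.ball (c : ℂ) (1 / 8) ⊆ U :=
    (Metric.ball_subset_closedBall.trans (Metric.closedBall_subset_closedBall (by norm_num))).trans
      hcU
  have hWF : Set.EqOn W F (Metric.ball (c : ℂ) (1 / 8)) := by
    refine ((hW.mono hball).analyticOnNhd Metric.isOpen_ball).eqOn_of_preconnected_of_frequently_eq
      (hF.analyticOnNhd Metric.isOpen_ball) (convex_ball _ _).isPreconnected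
      (Metric.mem_ball_self (by norm_num)) ?_
    have ht : Filter.Tendsto (fun t : ℝ => (t : ℂ)) (nhdsWithin c {c}ᶜ)
        (nhdsWithin (c : ℂ) {(c : ℂ)}ᶜ) := by
      refine tendsto_nhdsWithin_iff.2 ⟨(Complex.continuous_ofReal.tendsto c).mono_left
        nhdsWithin_le_nhds, ?_⟩
      filter_upwards [self_mem_nhdsWithin] with t ht
      simpa using ht
    refine ht.frequently (Filter.Eventually.frequently ?_)
    filter_upwards [mem_nhdsWithin_of_mem_nhds (Metric.ball_mem_nhds c (ε := 1 / 8) (by norm_num))]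
      with t ht
    exact heq t (by simpa [Real.dist_eq] using ht)
  have hM0 : 0 ≤ M := (norm_nonneg _).trans (hM c (hcU (Metric.mem_closedBall_self (by norm_num))))
  have hE0 : 0 ≤ E := (norm_nonneg _).trans (hE c (Metric.mem_ball_self (by norm_num)))
  have hsum := Complex.hasSum_taylorSeries_on_ball (c := (c : ℂ)) (r := 3 / 2)
    (hW.mono (Metric.ball_subset_closedBall.trans hcU))
    (Metric.closedBall_subset_ball (by norm_num) hz)
  have hg := (hasSum_geometric_of_lt_one hθ0 hθ1).mul_left (M ^ (9 / 10 : ℝ) * E ^ (1 / 10 : ℝ))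
  refine (hsum.norm_le_of_bounded hg fun k => ?_).trans_eq (by ring)
  have hk : (0 : ℝ) < k.factorial := by positivity
  have b1 := Complex.norm_iteratedDeriv_le_of_forall_mem_sphere_norm_le k (f := W) (c := (c : ℂ))
    (R := 3 / 2) (C := M) (by norm_num)
    (DifferentiableOn.diffContOnCl ((hW.mono (Metric.closure_ball_subset_closedBall.trans hcU))))
    fun z hz => hM z (hcU (Metric.sphere_subset_closedBall hz))
  have h19 : Metric.closedBall (c : ℂ) (1 / 9) ⊆ Metric.ball (c : ℂ) (1 / 8) :=
    Metric.closedBall_subset_ball (by norm_num)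
  have b2 := Complex.norm_iteratedDeriv_le_of_forall_mem_sphere_norm_le k (f := W) (c := (c : ℂ))
    (R := 1 / 9) (C := E) (by norm_num)
    (DifferentiableOn.diffContOnCl
      ((hW.mono (Metric.closure_ball_subset_closedBall.trans (h19.trans hball)))))
    fun z hz => by
      have hz' := h19 (Metric.sphere_subset_closedBall hz)
      rw [hWF hz']
      exact hE z hz'
  set D := ‖iteratedDeriv k W (c : ℂ)‖ with hD
  have hzc : ‖z - c‖ ≤ 1 := by simpa [dist_eq_norm] using hz
  have n1 : ‖((k.factorial : ℂ))⁻¹ • (z - c) ^ k • iteratedDeriv k W (c : ℂ)‖ ≤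
      D / k.factorial := by
    rw [norm_smul, norm_smul, norm_inv, norm_pow, Complex.norm_natCast, ← hD, div_eq_inv_mul]
    refine mul_le_mul_of_nonneg_left ?_ (by positivity)
    exact mul_le_of_le_one_left (norm_nonneg _) (pow_le_one₀ (norm_nonneg _) hzc)
  refine n1.trans ?_
  set d := D / k.factorial with hd
  have hd0 : 0 ≤ d := by positivity
  have d1 : d ≤ M * (2 / 3) ^ k := by
    rw [hd, div_le_iff₀ hk]
    refine b1.trans_eq ?_
    rw [show (2 / 3 : ℝ) = (3 / 2)⁻¹ by norm_num, inv_pow]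
    ring
  have d2 : d ≤ E * 9 ^ k := by
    rw [hd, div_le_iff₀ hk]
    refine b2.trans_eq ?_
    rw [show (9 : ℝ) = (1 / 9)⁻¹ by norm_num, inv_pow]
    ring
  have e1 : d = d ^ (9 / 10 : ℝ) * d ^ (1 / 10 : ℝ) := by
    rw [← Real.rpow_add_of_nonneg hd0 (by norm_num) (by norm_num)]
    norm_num
  rw [e1]
  calc d ^ (9 / 10 : ℝ) * d ^ (1 / 10 : ℝ)
      ≤ (M * (2 / 3) ^ k) ^ (9 / 10 : ℝ) * (E * 9 ^ k) ^ (1 / 10 : ℝ) := by gcongr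
    _ = M ^ (9 / 10 : ℝ) * E ^ (1 / 10 : ℝ) * θ ^ k := by
        rw [Real.mul_rpow hM0 (by positivity), Real.mul_rpow hE0 (by positivity), hθ, mul_pow,
          Real.rpow_pow_comm (by norm_num), Real.rpow_pow_comm (by norm_num)]
        ring

/-- The holomorphic extension of `radialKernel` to the right half-plane. -/
noncomputable def complexKernel (n : ℕ) (z : ℂ) : ℂ := z ^ (-((n : ℂ) + 1) / 2)

/-- The holomorphic extension of `radialPotential` to the right half-plane. -/
noncomputable def complexPotential (n : ℕ) (z : ℂ) : ℂ :=
  if n = 1 then Complex.log z else 2 / (1 - n) * z ^ ((1 - (n : ℂ)) / 2)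

theorem measurable_complexKernel (n : ℕ) : Measurable (complexKernel n) := by
  unfold complexKernel; fun_prop

theorem measurable_complexPotential (n : ℕ) : Measurable (complexPotential n) := by
  unfold complexPotential
  split_ifs <;> fun_prop

theorem differentiableOn_complexKernel (n : ℕ) :
    DifferentiableOn ℂ (complexKernel n) {z | 0 < z.re} := fun _ hz =>
  (differentiableAt_id.cpow_const (Complex.mem_slitPlane_iff.2 (Or.inl hz))).differentiableWithinAt

theorem differentiableOn_complexPotential (n : ℕ) :
    DifferentiableOn ℂ (complexPotential n) {z | 0 < z.re} := fun z hz => by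
  have hz' : z ∈ Complex.slitPlane := Complex.mem_slitPlane_iff.2 (Or.inl hz)
  unfold complexPotential
  split_ifs
  · exact (differentiableAt_id.clog hz').differentiableWithinAt
  · exact ((differentiableAt_id.cpow_const hz').const_mul _).differentiableWithinAt

theorem complexKernel_ofReal (n : ℕ) {s : ℝ} (hs : 0 ≤ s) :
    complexKernel n s = radialKernel n s := by
  unfold complexKernel radialKernel
  rw [Complex.ofReal_cpow hs]
  push_cast
  rfl

theorem complexPotential_ofReal (n : ℕ) {s : ℝ} (hs : 0 ≤ s) :
    complexPotential n s = radialPotential n s := by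
  unfold complexPotential radialPotential
  split_ifs
  · exact (Complex.ofReal_log hs).symm
  · push_cast
    rw [Complex.ofReal_cpow hs]
    push_cast
    rfl

theorem embt_eq {n : ℕ} (x' : Euc n) (t : ℝ) :
    embt x' t = emb x' + t • EuclideanSpace.single (Fin.last n) (1 : ℝ) := by
  ext i
  refine Fin.lastCases ?_ (fun j => ?_) i
  · simp [embt, emb]
  · simp [embt, emb, Fin.castSucc_ne_last]

theorem embt_apply_last {n : ℕ} (x' : Euc n) (t : ℝ) : embt x' t (Fin.last n) = t := by
  simp [embt]

theorem norm_sub_embt_sq {n : ℕ} (x' : Euc n) (t : ℝ) (y : Euc (n + 1)) :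
    ‖y - embt x' t‖ ^ 2 = t ^ 2 - 2 * t * y (Fin.last n) + ‖y - emb x'‖ ^ 2 := by
  rw [embt_eq, ← sub_sub, norm_sub_sq_real, inner_smul_right, norm_smul,
    PiLp.norm_single, EuclideanSpace.inner_single_right]
  simp only [PiLp.sub_apply, emb_apply_last, Real.norm_eq_abs, norm_one, mul_one, sq_abs]
  simp
  ring

theorem norm_emb_sub_embt_sq {n : ℕ} (x' y' : Euc n) (t : ℝ) :
    ‖emb y' - embt x' t‖ ^ 2 = t ^ 2 + ‖y' - x'‖ ^ 2 := by
  have h : emb y' - emb x' = emb (y' - x') := by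
    ext i
    refine Fin.lastCases ?_ (fun j => ?_) i
    · simp [emb_apply_last]
    · simp [emb_apply_castSucc]
  rw [norm_sub_embt_sq, emb_apply_last, h, norm_emb]
  ring

theorem radialDeriv_embt {n : ℕ} (χ : Euc (n + 1) → ℝ) (x' : Euc n) (t : ℝ) (y : Euc (n + 1)) :
    radialDeriv χ (embt x' t) y = radialDeriv χ (emb x') y -
      t * fderiv ℝ χ y (EuclideanSpace.single (Fin.last n) 1) := by
  unfold radialDeriv
  rw [Fin.sum_univ_castSucc, Fin.sum_univ_castSucc, embt_apply_last, emb_apply_last]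
  have : ∀ i : Fin n, embt x' t i.castSucc = emb x' i.castSucc := fun i => by simp [embt, emb]
  simp only [this]
  ring

theorem IsCutoff.exists_bound {n : ℕ} {χ : Euc (n + 1) → ℝ} (h : IsCutoff χ) :
    ∃ B, 0 ≤ B ∧ ∀ y, |χ y| ≤ B ∧ |lapl χ y| ≤ B ∧
      |fderiv ℝ χ y (EuclideanSpace.single (Fin.last n) 1)| ≤ B ∧
      ∀ x' : Euc n, ‖x'‖ ≤ 1 → |radialDeriv χ (emb x') y| ≤ B := by
  have hc : IsCompact (Metric.closedBall (0 : Euc (n + 1)) 16) := isCompact_closedBall _ _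
  obtain ⟨B1, h1⟩ := hc.exists_bound_of_continuousOn h.continuous_lapl.continuousOn
  obtain ⟨B2, h2⟩ := hc.exists_bound_of_continuousOn
    (f := fun y => fderiv ℝ χ y (EuclideanSpace.single (Fin.last n) 1))
    (h.continuous_fderiv.clm_apply continuous_const).continuousOn
  obtain ⟨B3, h3⟩ := ((isCompact_closedBall (0 : Euc n) 1).prod hc).exists_bound_of_continuousOn
    (f := fun z : Euc n × Euc (n + 1) => radialDeriv χ (emb z.1) z.2) (by
      refine Continuous.continuousOn ?_
      unfold radialDeriv
      refine continuous_finsetSum _ fun i _ => ?_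
      refine ((h.continuous_fderiv.comp continuous_snd).clm_apply continuous_const).mul ?_
      exact ((continuous_coord i).comp continuous_snd).sub
        ((continuous_coord i).comp ((continuous_emb n).comp continuous_fst)))
  obtain ⟨B4, h4⟩ := hc.exists_bound_of_continuousOn h.contDiff.continuous.continuousOn
  refine ⟨max (max |B1| |B4|) (max |B2| |B3|), by positivity, fun y => ?_⟩
  have l1 : |B1| ≤ max (max |B1| |B4|) (max |B2| |B3|) := by simp
  have l2 : |B2| ≤ max (max |B1| |B4|) (max |B2| |B3|) := by simp
  have l3 : |B3| ≤ max (max |B1| |B4|) (max |B2| |B3|) := by simp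
  have l4 : |B4| ≤ max (max |B1| |B4|) (max |B2| |B3|) := by simp
  by_cases hy : ‖y‖ ≤ 16
  · have hy' : y ∈ Metric.closedBall (0 : Euc (n + 1)) 16 := by simpa using hy
    refine ⟨((h4 y hy').trans (le_abs_self _)).trans l4,
      ((h1 y hy').trans (le_abs_self _)).trans l1, ((h2 y hy').trans (le_abs_self _)).trans l2,
      fun x' hx' => ?_⟩
    exact ((h3 (x', y) ⟨by simpa using hx', hy'⟩).trans (le_abs_self _)).trans l3
  · have hy' : 16 < ‖y‖ := not_le.1 hy
    rw [h.lapl_eq_zero (Or.inr hy'), h.fderiv_eq_zero (Or.inr hy'), h.eq_zero hy']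
    refine ⟨by simp, by simp, by simp, fun x' _ => ?_⟩
    rw [h.radialDeriv_eq_zero (Or.inr hy')]
    simp

theorem integral_upperHalf_abs_le {n : ℕ} {u A : Euc (n + 1) → ℝ}
    (hu : ContinuousOn u (closedHalf n)) (hA : IntegrableOn A (upperHalf n)) {b r : ℝ}
    (hb : ∀ y, |A y| ≤ b * |u y|) (h0 : ∀ y, r < ‖y‖ → A y = 0) :
    ∫ y in upperHalf n, |A y| ≤ b * ∫ y in upperHalf n ∩ Metric.closedBall 0 r, |u y| := by
  have hm := (isOpen_upperHalf n).measurableSet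
  have hu1 : IntegrableOn u (upperHalf n ∩ Metric.closedBall 0 r) :=
    ((hu.mono Set.inter_subset_left).integrableOn_compact
      ((isCompact_closedBall (0 : Euc (n + 1)) r).inter_left (isClosed_closedHalf n))).mono_set
      (Set.inter_subset_inter_left _ (upperHalf_subset_closedHalf n))
  have e : ∫ y in upperHalf n ∩ Metric.closedBall 0 r, |A y| = ∫ y in upperHalf n, |A y| := by
    refine (setIntegral_eq_of_subset_of_forall_sdiff_eq_zero hm Set.inter_subset_left ?_).symm
    rintro y ⟨hy1, hy2⟩
    rw [h0 y, abs_zero]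
    by_contra! h
    exact hy2 ⟨hy1, by simpa using h⟩
  rw [← e, ← integral_const_mul]
  exact integral_mono (hA.mono_set Set.inter_subset_left).abs (hu1.abs.const_mul b) fun y => hb y

theorem abs_last_le_norm_sub_emb {n : ℕ} (x' : Euc n) (y : Euc (n + 1)) :
    |y (Fin.last n)| ≤ ‖y - emb x'‖ := by
  have h := PiLp.norm_apply_le (y - emb x') (Fin.last n)
  simpa [emb_apply_last] using h

theorem re_complex_sq_dist {n : ℕ} {x' : Euc n} (hx : ‖x'‖ ≤ 1) {y : Euc (n + 1)}
    (h8 : 8 ≤ ‖y‖) (h16 : ‖y‖ ≤ 16) {t : ℂ} (ht : t ∈ Metric.ball (0 : ℂ) (9 / 4)) :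
    1 / 8 ≤ (t ^ 2 - 2 * t * (y (Fin.last n) : ℂ) + ((‖y - emb x'‖ ^ 2 : ℝ) : ℂ)).re ∧
      ‖t ^ 2 - 2 * t * (y (Fin.last n) : ℂ) + ((‖y - emb x'‖ ^ 2 : ℝ) : ℂ)‖ ≤ 400 := by
  have ht' : ‖t‖ < 9 / 4 := by simpa using ht
  have hq := abs_last_le_norm_sub_emb x' y
  have hxe := norm_emb x'
  have hr1 : 7 ≤ ‖y - emb x'‖ := by
    have := norm_sub_norm_le y (emb x')
    linarith
  have hr2 : ‖y - emb x'‖ ≤ 17 := by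
    have := norm_sub_le y (emb x')
    linarith
  set r := ‖y - emb x'‖
  have h1 : ‖t ^ 2 - 2 * t * (y (Fin.last n) : ℂ)‖ ≤ 81 / 16 + 9 / 2 * r := by
    refine (norm_sub_le _ _).trans ?_
    rw [norm_pow, norm_mul, norm_mul, Complex.norm_real, Complex.norm_ofNat, Real.norm_eq_abs]
    have h2 : ‖t‖ ^ 2 ≤ (9 / 4) ^ 2 := by gcongr
    have h3 : ‖t‖ * |y (Fin.last n)| ≤ 9 / 4 * r := by gcongr
    nlinarith
  constructor
  · rw [Complex.add_re, Complex.ofReal_re]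
    have := (abs_le.1 ((Complex.abs_re_le_norm _).trans h1)).1
    nlinarith
  · refine (norm_add_le _ _).trans ?_
    rw [Complex.norm_real, Real.norm_eq_abs, abs_of_nonneg (by positivity)]
    nlinarith

theorem re_complex_sq_dist_boundary {n : ℕ} {x' : Euc n} (hx : ‖x'‖ ≤ 1) {y' : Euc n}
    (h16 : ‖y'‖ ≤ 16) {t : ℂ} (ht : t ∈ Metric.ball ((-1 / 2 : ℝ) : ℂ) (1 / 8)) :
    1 / 8 ≤ (t ^ 2 + ((‖y' - x'‖ ^ 2 : ℝ) : ℂ)).re ∧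
      ‖t ^ 2 + ((‖y' - x'‖ ^ 2 : ℝ) : ℂ)‖ ≤ 400 ∧ ‖t‖ ≤ 1 := by
  have ht' : ‖t - ((-1 / 2 : ℝ) : ℂ)‖ < 1 / 8 := by rwa [Metric.mem_ball, dist_eq_norm] at ht
  have hre := (Complex.abs_re_le_norm _).trans ht'.le
  have him := (Complex.abs_im_le_norm _).trans ht'.le
  simp only [Complex.sub_re, Complex.sub_im, Complex.ofReal_re, Complex.ofReal_im] at hre him
  have hn : ‖t‖ ≤ 1 := by
    have h1 : ‖t‖ ≤ ‖t - ((-1 / 2 : ℝ) : ℂ)‖ + ‖((-1 / 2 : ℝ) : ℂ)‖ := by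
      simpa using norm_add_le (t - ((-1 / 2 : ℝ) : ℂ)) ((-1 / 2 : ℝ) : ℂ)
    rw [Complex.norm_real, Real.norm_eq_abs, abs_of_neg (by norm_num : (-1 / 2 : ℝ) < 0)] at h1
    linarith
  have hr2 : ‖y' - x'‖ ≤ 17 := by
    have := norm_sub_le y' x'
    linarith
  refine ⟨?_, ?_, hn⟩
  · rw [Complex.add_re, Complex.ofReal_re, sq, Complex.mul_re]
    have := abs_le.1 hre
    have := abs_le.1 him
    nlinarith [sq_nonneg ‖y' - x'‖]
  · refine (norm_add_le _ _).trans ?_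
    rw [Complex.norm_real, Real.norm_eq_abs, abs_of_nonneg (by positivity), norm_pow]
    nlinarith [norm_nonneg t, norm_nonneg (y' - x')]

/-- The volume potential in the representation formula along the vertical line through `emb x'`,
continued to complex heights. -/
noncomputable def volumeTerm {n : ℕ} (χ u : Euc (n + 1) → ℝ) (x' : Euc n) (t : ℂ) : ℂ :=
  (∫ y in upperHalf n, complexKernel n
      (t ^ 2 - 2 * t * (y (Fin.last n) : ℂ) + ((‖y - emb x'‖ ^ 2 : ℝ) : ℂ)) *
        ((4 * u y * radialDeriv χ (emb x') y : ℝ) : ℂ)) +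
    t * (∫ y in upperHalf n, complexKernel n
      (t ^ 2 - 2 * t * (y (Fin.last n) : ℂ) + ((‖y - emb x'‖ ^ 2 : ℝ) : ℂ)) *
        ((-4 * u y * fderiv ℝ χ y (EuclideanSpace.single (Fin.last n) 1) : ℝ) : ℂ)) +
    ∫ y in upperHalf n, complexPotential n
      (t ^ 2 - 2 * t * (y (Fin.last n) : ℂ) + ((‖y - emb x'‖ ^ 2 : ℝ) : ℂ)) *
        ((u y * lapl χ y : ℝ) : ℂ)

/-- The layer potentials in the representation formula along the vertical line through `emb x'`,
continued to complex heights. -/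
noncomputable def boundaryTerm {n : ℕ} (χ u : Euc (n + 1) → ℝ) (x' : Euc n) (t : ℂ) : ℂ :=
  (∫ y' : Euc n, complexPotential n (t ^ 2 + ((‖y' - x'‖ ^ 2 : ℝ) : ℂ)) *
      (singleDensity χ u y' : ℂ)) +
    2 * t * ∫ y' : Euc n, complexKernel n (t ^ 2 + ((‖y' - x'‖ ^ 2 : ℝ) : ℂ)) *
      (doubleDensity χ u y' : ℂ)

theorem IsCutoff.volume_densities {n : ℕ} {χ u : Euc (n + 1) → ℝ} (hχ : IsCutoff χ)
    (hu : ContinuousOn u (closedHalf n)) (x' : Euc n) :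
    IntegrableOn (fun y => 4 * u y * radialDeriv χ (emb x') y) (upperHalf n) ∧
    IntegrableOn (fun y => -4 * u y * fderiv ℝ χ y (EuclideanSpace.single (Fin.last n) 1))
      (upperHalf n) ∧
    IntegrableOn (fun y => u y * lapl χ y) (upperHalf n) := by
  refine ⟨integrableOn_upperHalf (r := 16) ?_ ?_, integrableOn_upperHalf (r := 16) ?_ ?_,
    integrableOn_upperHalf (r := 16) ?_ ?_⟩
  · exact (continuousOn_const.mul hu).mul (hχ.continuous_radialDeriv _).continuousOn
  · intro y hy
    rw [hχ.radialDeriv_eq_zero (Or.inr hy), mul_zero]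
  · exact (continuousOn_const.mul hu).mul
      (hχ.continuous_fderiv.clm_apply continuous_const).continuousOn
  · intro y hy
    rw [hχ.fderiv_eq_zero (Or.inr hy)]
    simp
  · exact hu.mul hχ.continuous_lapl.continuousOn
  · intro y hy
    rw [hχ.lapl_eq_zero (Or.inr hy), mul_zero]

theorem IsCutoff.norm_mem_of_ne_zero {m : ℕ} {χ : Euc m → ℝ} (hχ : IsCutoff χ) (x : Euc m)
    (v : Euc m) {y : Euc m}
    (h : radialDeriv χ x y ≠ 0 ∨ fderiv ℝ χ y v ≠ 0 ∨ lapl χ y ≠ 0) :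
    8 ≤ ‖y‖ ∧ ‖y‖ ≤ 16 := by
  by_contra hy
  have hy' : ‖y‖ < 8 ∨ 16 < ‖y‖ := by
    by_contra! h'
    exact hy h'
  rw [hχ.radialDeriv_eq_zero hy', hχ.fderiv_eq_zero hy', hχ.lapl_eq_zero hy'] at h
  simp at h

theorem differentiableOn_volumeTerm {n : ℕ} {χ u : Euc (n + 1) → ℝ} (hχ : IsCutoff χ)
    (hu : ContinuousOn u (closedHalf n)) {x' : Euc n} (hx : ‖x'‖ ≤ 1) :
    DifferentiableOn ℂ (volumeTerm χ u x') (Metric.ball 0 (9 / 4)) := by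
  obtain ⟨i1, i2, i3⟩ := hχ.volume_densities hu x'
  have hp : Measurable fun y : Euc (n + 1) => ‖y - emb x'‖ ^ 2 := by fun_prop
  have hq : Measurable fun y : Euc (n + 1) => y (Fin.last n) :=
    (continuous_coord _).measurable
  have hT : ∀ t ∈ Metric.ball (0 : ℂ) (9 / 4), ‖t‖ ≤ 9 / 4 := fun t ht => by
    have : ‖t‖ < 9 / 4 := by simpa using ht
    exact this.le
  have hQ : ∀ y : Euc (n + 1), ‖y‖ ≤ 16 → |y (Fin.last n)| ≤ 16 := fun y hy =>
    (PiLp.norm_apply_le y (Fin.last n)).trans hy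
  have s1 : ∀ y, 4 * u y * radialDeriv χ (emb x') y ≠ 0 → 8 ≤ ‖y‖ ∧ ‖y‖ ≤ 16 := fun y hy =>
    hχ.norm_mem_of_ne_zero (emb x') 0 (Or.inl (right_ne_zero_of_mul hy))
  have s2 : ∀ y, -4 * u y * fderiv ℝ χ y (EuclideanSpace.single (Fin.last n) 1) ≠ 0 →
      8 ≤ ‖y‖ ∧ ‖y‖ ≤ 16 := fun y hy =>
    hχ.norm_mem_of_ne_zero (emb x') _ (Or.inr (Or.inl (right_ne_zero_of_mul hy)))
  have s3 : ∀ y, u y * lapl χ y ≠ 0 → 8 ≤ ‖y‖ ∧ ‖y‖ ≤ 16 := fun y hy =>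
    hχ.norm_mem_of_ne_zero (emb x') 0 (Or.inr (Or.inr (right_ne_zero_of_mul hy)))
  have d1 := differentiableOn_integral_comp_mul (differentiableOn_complexKernel n)
    (measurable_complexKernel n) i1 hp hq Metric.isOpen_ball (m := 1 / 8) (by norm_num) hT
    (fun t ht y hy => re_complex_sq_dist hx (s1 y hy).1 (s1 y hy).2 ht)
    (fun y hy => hQ y (s1 y hy).2)
  have d2 := differentiableOn_integral_comp_mul (differentiableOn_complexKernel n)
    (measurable_complexKernel n) i2 hp hq Metric.isOpen_ball (m := 1 / 8) (by norm_num) hT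
    (fun t ht y hy => re_complex_sq_dist hx (s2 y hy).1 (s2 y hy).2 ht)
    (fun y hy => hQ y (s2 y hy).2)
  have d3 := differentiableOn_integral_comp_mul (differentiableOn_complexPotential n)
    (measurable_complexPotential n) i3 hp hq Metric.isOpen_ball (m := 1 / 8) (by norm_num) hT
    (fun t ht y hy => re_complex_sq_dist hx (s3 y hy).1 (s3 y hy).2 ht)
    (fun y hy => hQ y (s3 y hy).2)
  exact (d1.add (differentiableOn_id.mul d2)).add d3

theorem IsCutoff.exists_norm_volumeTerm_le {n : ℕ} {χ : Euc (n + 1) → ℝ} (hχ : IsCutoff χ) :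
    ∃ C, 0 ≤ C ∧ ∀ u : Euc (n + 1) → ℝ, ContinuousOn u (closedHalf n) → ∀ x' : Euc n,
      ‖x'‖ ≤ 1 → ∀ t ∈ Metric.ball (0 : ℂ) (9 / 4), ‖volumeTerm χ u x' t‖ ≤
        C * ∫ y in upperHalf n ∩ Metric.closedBall 0 16, |u y| := by
  obtain ⟨C1, hC1, h1⟩ := exists_norm_le_of_differentiableOn_re_pos
    (differentiableOn_complexKernel n) (m := 1 / 8) (by norm_num) 400
  obtain ⟨C2, hC2, h2⟩ := exists_norm_le_of_differentiableOn_re_pos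
    (differentiableOn_complexPotential n) (m := 1 / 8) (by norm_num) 400
  obtain ⟨B, hB, hχB⟩ := hχ.exists_bound
  refine ⟨C1 * (4 * B) + 9 / 4 * (C1 * (4 * B)) + C2 * B, by positivity,
    fun u hu x' hx t ht => ?_⟩
  obtain ⟨i1, i2, i3⟩ := hχ.volume_densities hu x'
  have ht' : ‖t‖ ≤ 9 / 4 := by
    have : ‖t‖ < 9 / 4 := by simpa using ht
    exact this.le
  set I := ∫ y in upperHalf n ∩ Metric.closedBall 0 16, |u y| with hI
  have hI0 : 0 ≤ I := integral_nonneg fun y => abs_nonneg _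
  have n1 := norm_integral_comp_mul_le (K := complexKernel n) (C := C1) i1
    (s := fun y => t ^ 2 - 2 * t * (y (Fin.last n) : ℂ) + ((‖y - emb x'‖ ^ 2 : ℝ) : ℂ))
    fun y hy => by
      have s := hχ.norm_mem_of_ne_zero (emb x') 0 (Or.inl (right_ne_zero_of_mul hy))
      exact h1 _ (re_complex_sq_dist hx s.1 s.2 ht).1 (re_complex_sq_dist hx s.1 s.2 ht).2
  have n2 := norm_integral_comp_mul_le (K := complexKernel n) (C := C1) i2
    (s := fun y => t ^ 2 - 2 * t * (y (Fin.last n) : ℂ) + ((‖y - emb x'‖ ^ 2 : ℝ) : ℂ))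
    fun y hy => by
      have s := hχ.norm_mem_of_ne_zero (emb x') _ (Or.inr (Or.inl (right_ne_zero_of_mul hy)))
      exact h1 _ (re_complex_sq_dist hx s.1 s.2 ht).1 (re_complex_sq_dist hx s.1 s.2 ht).2
  have n3 := norm_integral_comp_mul_le (K := complexPotential n) (C := C2) i3
    (s := fun y => t ^ 2 - 2 * t * (y (Fin.last n) : ℂ) + ((‖y - emb x'‖ ^ 2 : ℝ) : ℂ))
    fun y hy => by
      have s := hχ.norm_mem_of_ne_zero (emb x') 0 (Or.inr (Or.inr (right_ne_zero_of_mul hy)))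
      exact h2 _ (re_complex_sq_dist hx s.1 s.2 ht).1 (re_complex_sq_dist hx s.1 s.2 ht).2
  have a1 := integral_upperHalf_abs_le (b := 4 * B) (r := 16) hu i1 (fun y => by
    rw [abs_mul, abs_mul, abs_of_pos (by norm_num : (0 : ℝ) < 4)]
    have := mul_le_mul_of_nonneg_left ((hχB y).2.2.2 x' hx) (abs_nonneg (u y))
    linarith) fun y hy => by
      rw [hχ.radialDeriv_eq_zero (Or.inr hy), mul_zero]
  have a2 := integral_upperHalf_abs_le (b := 4 * B) (r := 16) hu i2 (fun y => by
    rw [abs_mul, abs_mul, abs_neg, abs_of_pos (by norm_num : (0 : ℝ) < 4)]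
    have := mul_le_mul_of_nonneg_left ((hχB y).2.2.1) (abs_nonneg (u y))
    linarith) fun y hy => by
      rw [hχ.fderiv_eq_zero (Or.inr hy)]
      simp
  have a3 := integral_upperHalf_abs_le (b := B) (r := 16) hu i3 (fun y => by
    rw [abs_mul]
    have := mul_le_mul_of_nonneg_left ((hχB y).2.1) (abs_nonneg (u y))
    linarith) fun y hy => by
      rw [hχ.lapl_eq_zero (Or.inr hy), mul_zero]
  have m1 := n1.trans (mul_le_mul_of_nonneg_left a1 hC1)
  have m2 := n2.trans (mul_le_mul_of_nonneg_left a2 hC1)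
  have m3 := n3.trans (mul_le_mul_of_nonneg_left a3 hC2)
  unfold volumeTerm
  refine (norm_add₃_le).trans ?_
  rw [norm_mul]
  have m2' := mul_le_mul ht' m2 (norm_nonneg _) (by norm_num)
  refine (add_le_add (add_le_add m1 m2') m3).trans_eq ?_
  rw [← hI]
  ring

theorem differentiableOn_boundaryTerm {n : ℕ} {χ u : Euc (n + 1) → ℝ} (hχ : IsCutoff χ)
    (hu : ContDiffOn ℝ 1 u (closedHalf n)) {x' : Euc n} (hx : ‖x'‖ ≤ 1) :
    DifferentiableOn ℂ (boundaryTerm χ u x') (Metric.ball ((-1 / 2 : ℝ) : ℂ) (1 / 8)) := by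
  have i1 := integrable_of_continuous_of_bounded_support (hχ.continuous_singleDensity hu)
    fun y hy => hχ.singleDensity_eq_zero hy
  have i2 := integrable_of_continuous_of_bounded_support (hχ.continuous_doubleDensity hu)
    fun y hy => hχ.doubleDensity_eq_zero hy
  have hp : Measurable fun y : Euc n => ‖y - x'‖ ^ 2 := by fun_prop
  have hq : Measurable fun _ : Euc n => (0 : ℝ) := measurable_const
  have s1 : ∀ y, singleDensity χ u y ≠ 0 → ‖y‖ ≤ 16 := fun y hy => by
    by_contra! h
    exact hy (hχ.singleDensity_eq_zero h)
  have s2 : ∀ y, doubleDensity χ u y ≠ 0 → ‖y‖ ≤ 16 := fun y hy => by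
    by_contra! h
    exact hy (hχ.doubleDensity_eq_zero h)
  have d1 := differentiableOn_integral_comp_mul (differentiableOn_complexPotential n)
    (measurable_complexPotential n) i1 hp hq
    (Metric.isOpen_ball (x := ((-1 / 2 : ℝ) : ℂ)) (ε := 1 / 8)) (m := 1 / 8) (M := 400) (Q := 0)
    (T := 1) (by norm_num)
    (fun t ht => (re_complex_sq_dist_boundary hx (y' := 0) (by simp) ht).2.2)
    (fun t ht y hy => by
      have := re_complex_sq_dist_boundary hx (s1 y hy) ht
      simpa using And.intro this.1 this.2.1)
    (fun y hy => by simp)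
  have d2 := differentiableOn_integral_comp_mul (differentiableOn_complexKernel n)
    (measurable_complexKernel n) i2 hp hq
    (Metric.isOpen_ball (x := ((-1 / 2 : ℝ) : ℂ)) (ε := 1 / 8)) (m := 1 / 8) (M := 400) (Q := 0)
    (T := 1) (by norm_num)
    (fun t ht => (re_complex_sq_dist_boundary hx (y' := 0) (by simp) ht).2.2)
    (fun t ht y hy => by
      have := re_complex_sq_dist_boundary hx (s2 y hy) ht
      simpa using And.intro this.1 this.2.1)
    (fun y hy => by simp)
  simp only [Complex.ofReal_zero, mul_zero, sub_zero] at d1 d2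
  exact d1.add ((differentiableOn_id.const_mul 2).mul d2)

theorem exists_norm_boundaryTerm_le (n : ℕ) :
    ∃ C, 0 ≤ C ∧ ∀ χ u : Euc (n + 1) → ℝ, IsCutoff χ → ContDiffOn ℝ 1 u (closedHalf n) →
      ∀ x' : Euc n, ‖x'‖ ≤ 1 → ∀ t ∈ Metric.ball ((-1 / 2 : ℝ) : ℂ) (1 / 8),
        ‖boundaryTerm χ u x' t‖ ≤
          C * ((∫ y', |singleDensity χ u y'|) + ∫ y', |doubleDensity χ u y'|) := by
  obtain ⟨C1, hC1, h1⟩ := exists_norm_le_of_differentiableOn_re_pos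
    (differentiableOn_complexKernel n) (m := 1 / 8) (by norm_num) 400
  obtain ⟨C2, hC2, h2⟩ := exists_norm_le_of_differentiableOn_re_pos
    (differentiableOn_complexPotential n) (m := 1 / 8) (by norm_num) 400
  refine ⟨2 * C1 + C2, by positivity, fun χ u hχ hu x' hx t ht => ?_⟩
  have i1 := integrable_of_continuous_of_bounded_support (hχ.continuous_singleDensity hu)
    fun y hy => hχ.singleDensity_eq_zero hy
  have i2 := integrable_of_continuous_of_bounded_support (hχ.continuous_doubleDensity hu)
    fun y hy => hχ.doubleDensity_eq_zero hy
  have n1 := norm_integral_comp_mul_le (K := complexPotential n) (C := C2) i1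
    (s := fun y => t ^ 2 + ((‖y - x'‖ ^ 2 : ℝ) : ℂ)) fun y hy => by
      have hy' : ‖y‖ ≤ 16 := by
        by_contra! h
        exact hy (hχ.singleDensity_eq_zero h)
      have := re_complex_sq_dist_boundary hx hy' ht
      exact h2 _ this.1 this.2.1
  have n2 := norm_integral_comp_mul_le (K := complexKernel n) (C := C1) i2
    (s := fun y => t ^ 2 + ((‖y - x'‖ ^ 2 : ℝ) : ℂ)) fun y hy => by
      have hy' : ‖y‖ ≤ 16 := by
        by_contra! h
        exact hy (hχ.doubleDensity_eq_zero h)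
      have := re_complex_sq_dist_boundary hx hy' ht
      exact h1 _ this.1 this.2.1
  have ht' := (re_complex_sq_dist_boundary hx (y' := 0) (by simp) ht).2.2
  unfold boundaryTerm
  refine (norm_add_le _ _).trans ?_
  rw [norm_mul, norm_mul, Complex.norm_ofNat]
  have I1 : 0 ≤ ∫ y', |singleDensity χ u y'| := integral_nonneg fun y => abs_nonneg _
  have I2 : 0 ≤ ∫ y', |doubleDensity χ u y'| := integral_nonneg fun y => abs_nonneg _
  have n2' := mul_le_mul (mul_le_mul_of_nonneg_left ht' zero_le_two) n2 (norm_nonneg _)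
    (by norm_num)
  refine (add_le_add n1 n2').trans ?_
  nlinarith [mul_nonneg hC1 I1, mul_nonneg hC2 I2]

theorem norm_embt_le {n : ℕ} (x' : Euc n) (t : ℝ) : ‖embt x' t‖ ≤ ‖x'‖ + |t| := by
  rw [embt_eq]
  refine (norm_add_le _ _).trans ?_
  rw [norm_emb, norm_smul, PiLp.norm_single]
  simp

theorem volumeTerm_ofReal {n : ℕ} {χ u : Euc (n + 1) → ℝ} (hχ : IsCutoff χ)
    (hu : ContinuousOn u (closedHalf n)) {x' : Euc n} (hx : ‖x'‖ ≤ 1) {t : ℝ} (ht : |t| ≤ 2) :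
    volumeTerm χ u x' t =
      (((∫ y in upperHalf n, radialKernel n (‖y - embt x' t‖ ^ 2) *
          (4 * u y * radialDeriv χ (embt x' t) y)) +
        ∫ y in upperHalf n, radialPotential n (‖y - embt x' t‖ ^ 2) * (u y * lapl χ y) : ℝ) : ℂ) := by
  obtain ⟨i1, i2, -⟩ := hχ.volume_densities hu x'
  have hs : ∀ y : Euc (n + 1), (t : ℂ) ^ 2 - 2 * t * (y (Fin.last n) : ℂ) +
      ((‖y - emb x'‖ ^ 2 : ℝ) : ℂ) = ((‖y - embt x' t‖ ^ 2 : ℝ) : ℂ) := fun y => by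
    rw [norm_sub_embt_sq]
    push_cast
    ring
  have hK : ∀ A : Euc (n + 1) → ℝ, (∫ y in upperHalf n, complexKernel n
      ((t : ℂ) ^ 2 - 2 * t * (y (Fin.last n) : ℂ) + ((‖y - emb x'‖ ^ 2 : ℝ) : ℂ)) * (A y : ℂ)) =
      ((∫ y in upperHalf n, radialKernel n (‖y - embt x' t‖ ^ 2) * A y : ℝ) : ℂ) := fun A => by
    rw [← integral_complex_ofReal]
    refine integral_congr_ae (Filter.Eventually.of_forall fun y => ?_)
    simp only
    rw [hs, complexKernel_ofReal n (by positivity)]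
    push_cast
    rfl
  have hP : ∀ A : Euc (n + 1) → ℝ, (∫ y in upperHalf n, complexPotential n
      ((t : ℂ) ^ 2 - 2 * t * (y (Fin.last n) : ℂ) + ((‖y - emb x'‖ ^ 2 : ℝ) : ℂ)) * (A y : ℂ)) =
      ((∫ y in upperHalf n, radialPotential n (‖y - embt x' t‖ ^ 2) * A y : ℝ) : ℂ) := fun A => by
    rw [← integral_complex_ofReal]
    refine integral_congr_ae (Filter.Eventually.of_forall fun y => ?_)
    simp only
    rw [hs, complexPotential_ofReal n (by positivity)]
    push_cast
    rfl
  have htb : (t : ℂ) ∈ Metric.ball (0 : ℂ) (9 / 4) := by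
    rw [mem_ball_zero_iff, Complex.norm_real, Real.norm_eq_abs]
    linarith
  have hmem : ∀ y : Euc (n + 1), 8 ≤ ‖y‖ ∧ ‖y‖ ≤ 16 →
      ‖y - embt x' t‖ ^ 2 ∈ Set.Icc (1 / 8 : ℝ) 400 := fun y hy => by
    have := re_complex_sq_dist hx hy.1 hy.2 htb
    rw [hs, Complex.ofReal_re, Complex.norm_real, Real.norm_eq_abs,
      abs_of_nonneg (by positivity)] at this
    exact this
  have hσ : Measurable fun y : Euc (n + 1) => ‖y - embt x' t‖ ^ 2 := by fun_prop
  have j1 := integrable_comp_mul (measurable_radialKernel n) (continuousOn_radialKernel n) i1 hσ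
    (m := 1 / 8) (by norm_num) fun y hy => hmem y
      (hχ.norm_mem_of_ne_zero (emb x') 0 (Or.inl (right_ne_zero_of_mul hy)))
  have j2 := integrable_comp_mul (measurable_radialKernel n) (continuousOn_radialKernel n) i2 hσ
    (m := 1 / 8) (by norm_num) fun y hy => hmem y
      (hχ.norm_mem_of_ne_zero (emb x') _ (Or.inr (Or.inl (right_ne_zero_of_mul hy))))
  unfold volumeTerm
  rw [hK, hK, hP]
  rw [← Complex.ofReal_mul, ← Complex.ofReal_add, ← Complex.ofReal_add, Complex.ofReal_inj,
    ← integral_const_mul, ← integral_add j1 (j2.const_mul t)]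
  congr 1
  refine integral_congr_ae (Filter.Eventually.of_forall fun y => ?_)
  simp only [radialDeriv_embt]
  ring

theorem boundaryTerm_ofReal {n : ℕ} (χ u : Euc (n + 1) → ℝ) (x' : Euc n) (t : ℝ) :
    boundaryTerm χ u x' t =
      (((∫ y' : Euc n, radialPotential n (t ^ 2 + ‖y' - x'‖ ^ 2) * singleDensity χ u y') +
        2 * t * ∫ y' : Euc n, radialKernel n (t ^ 2 + ‖y' - x'‖ ^ 2) *
          doubleDensity χ u y' : ℝ) : ℂ) := by
  have hs : ∀ y : Euc n, (t : ℂ) ^ 2 + ((‖y - x'‖ ^ 2 : ℝ) : ℂ) =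
      ((t ^ 2 + ‖y - x'‖ ^ 2 : ℝ) : ℂ) := fun y => by
    push_cast
    ring
  have hK : ∀ A : Euc n → ℝ,
      (∫ y, complexKernel n ((t : ℂ) ^ 2 + ((‖y - x'‖ ^ 2 : ℝ) : ℂ)) * (A y : ℂ)) =
      ((∫ y, radialKernel n (t ^ 2 + ‖y - x'‖ ^ 2) * A y : ℝ) : ℂ) := fun A => by
    rw [← integral_complex_ofReal]
    refine integral_congr_ae (Filter.Eventually.of_forall fun y => ?_)
    simp only
    rw [hs, complexKernel_ofReal n (by positivity), Complex.ofReal_mul]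
  have hP : ∀ A : Euc n → ℝ,
      (∫ y, complexPotential n ((t : ℂ) ^ 2 + ((‖y - x'‖ ^ 2 : ℝ) : ℂ)) * (A y : ℂ)) =
      ((∫ y, radialPotential n (t ^ 2 + ‖y - x'‖ ^ 2) * A y : ℝ) : ℂ) := fun A => by
    rw [← integral_complex_ofReal]
    refine integral_congr_ae (Filter.Eventually.of_forall fun y => ?_)
    simp only
    rw [hs, complexPotential_ofReal n (by positivity), Complex.ofReal_mul]
  unfold boundaryTerm
  rw [hK, hP]
  push_cast
  rfl

theorem representation_formula_vertical {n : ℕ} {χ u : Euc (n + 1) → ℝ} (hχ : IsCutoff χ)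
    (hu : ContDiffOn ℝ 1 u (closedHalf n)) (hh : HarmonicOnSet u (upperHalf n))
    {x' : Euc n} (hx : ‖x'‖ ≤ 1) {t : ℝ} (ht : |t| ≤ 2) (ht0 : t ≠ 0) :
    ((2 * (n + 1) * potentialMass n * (upperHalf n).indicator u (embt x' t) : ℝ) : ℂ) +
      volumeTerm χ u x' t = boundaryTerm χ u x' t := by
  have key := representation_formula hχ hu hh (x := embt x' t)
    (by have := norm_embt_le x' t; linarith) (by rwa [embt_apply_last])
  rw [volumeTerm_ofReal hχ hu.continuousOn hx ht, boundaryTerm_ofReal, ← Complex.ofReal_add, key]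
  simp only [norm_emb_sub_embt_sq, embt_apply_last]
  rw [← integral_const_mul]
  congr 2
  refine integral_congr_ae (Filter.Eventually.of_forall fun y => ?_)
  simp only
  ring

/-- The double layer potential, up to the factor given by the height `t`. -/
noncomputable def doubleLayer {n : ℕ} (χ u : Euc (n + 1) → ℝ) (x' : Euc n) (t : ℝ) : ℝ :=
  ∫ y' : Euc n, radialKernel n (t ^ 2 + ‖y' - x'‖ ^ 2) * doubleDensity χ u y'

theorem IsCutoff.exists_abs_le {n : ℕ} {χ : Euc (n + 1) → ℝ} (hχ : IsCutoff χ) :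
    ∃ C, 0 ≤ C ∧ ∀ u : Euc (n + 1) → ℝ, ContDiffOn ℝ 1 u (closedHalf n) →
      HarmonicOnSet u (upperHalf n) → ∀ x' : Euc n, ‖x'‖ ≤ 1 → ∀ t : ℝ, 0 < t → t ≤ 1 / 2 →
        |u (embt x' t)| ≤
          C * (∫ y in upperHalf n ∩ Metric.closedBall 0 16, |u y|) ^ (9 / 10 : ℝ) *
            ((∫ y', |singleDensity χ u y'|) + ∫ y', |doubleDensity χ u y'|) ^ (1 / 10 : ℝ) +
          C * |t * doubleLayer χ u x' t| := by
  obtain ⟨C0, hC0, h0⟩ := exists_norm_le_rpow_mul_rpow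
  obtain ⟨C1, hC1, h1⟩ := hχ.exists_norm_volumeTerm_le
  obtain ⟨C2, hC2, h2⟩ := exists_norm_boundaryTerm_le n
  have hκ : 0 < 2 * (n + 1) * potentialMass n := by
    have := potentialMass_pos n
    positivity
  set κ := 2 * (n + 1) * potentialMass n
  refine ⟨κ⁻¹ * (2 * (C0 * C1 ^ (9 / 10 : ℝ) * C2 ^ (1 / 10 : ℝ)) + 4), by positivity,
    fun u hu hh x' hx t ht0 ht1 => ?_⟩
  set I := ∫ y in upperHalf n ∩ Metric.closedBall 0 16, |u y| with hI
  set J := (∫ y', |singleDensity χ u y'|) + ∫ y', |doubleDensity χ u y'| with hJ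
  have hI0 : 0 ≤ I := integral_nonneg fun y => abs_nonneg _
  have hJ0 : 0 ≤ J := add_nonneg (integral_nonneg fun y => abs_nonneg _)
    (integral_nonneg fun y => abs_nonneg _)
  have hneg : ∀ s : ℝ, s < 0 → (upperHalf n).indicator u (embt x' s) = 0 := fun s hs =>
    Set.indicator_of_notMem (fun h => by
      have h' : 0 < embt x' s (Fin.last n) := h
      rw [embt_apply_last] at h'
      linarith) _
  have hV : ∀ s : ℝ, |s| ≤ 1 / 2 → ‖volumeTerm χ u x' s‖ ≤
      C0 * (C1 * I) ^ (9 / 10 : ℝ) * (C2 * J) ^ (1 / 10 : ℝ) := by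
    intro s hs
    refine h0 (volumeTerm χ u x') (boundaryTerm χ u x') (-1 / 2 : ℝ) (Metric.ball 0 (9 / 4)) _ _
      Metric.isOpen_ball ?_ (differentiableOn_volumeTerm hχ hu.continuousOn hx)
      (differentiableOn_boundaryTerm hχ hu hx) (h1 u hu.continuousOn x' hx) (h2 χ u hχ hu x' hx)
      ?_ s ?_
    · refine Metric.closedBall_subset_ball' ?_
      rw [dist_zero_right, Complex.norm_real]
      norm_num [abs_of_pos]
    · intro r hr
      have hr' := abs_lt.1 hr
      have := representation_formula_vertical hχ hu hh hx (t := r)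
        (abs_le.2 ⟨by linarith, by linarith⟩) (by linarith)
      rwa [hneg r (by linarith), mul_zero, Complex.ofReal_zero, zero_add] at this
    · have := abs_le.1 hs
      rw [Metric.mem_closedBall, dist_eq_norm, ← Complex.ofReal_sub, Complex.norm_real,
        Real.norm_eq_abs, abs_le]
      constructor <;> linarith
  have e1 := representation_formula_vertical hχ hu hh hx (t := t)
    (abs_le.2 ⟨by linarith, by linarith⟩) ht0.ne'
  have e2 := representation_formula_vertical hχ hu hh hx (t := -t)
    (abs_le.2 ⟨by linarith, by linarith⟩) (by linarith)
  rw [hneg (-t) (by linarith), mul_zero, Complex.ofReal_zero, zero_add, boundaryTerm_ofReal] at e2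
  have hmem : embt x' t ∈ upperHalf n := by
    show 0 < embt x' t (Fin.last n)
    rwa [embt_apply_last]
  rw [Set.indicator_of_mem hmem, boundaryTerm_ofReal] at e1
  have e3 : ((κ * u (embt x' t) : ℝ) : ℂ) = volumeTerm χ u x' (-t : ℝ) - volumeTerm χ u x' t +
      ((4 * (t * doubleLayer χ u x' t) : ℝ) : ℂ) := by
    rw [e2, eq_sub_of_add_eq e1]
    unfold doubleLayer
    push_cast
    simp only [neg_sq]
    ring
  have e4 : κ * |u (embt x' t)| ≤ 2 * (C0 * (C1 * I) ^ (9 / 10 : ℝ) * (C2 * J) ^ (1 / 10 : ℝ)) +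
      4 * |t * doubleLayer χ u x' t| := by
    have h := congrArg norm e3
    rw [Complex.norm_real, Real.norm_eq_abs, abs_mul, abs_of_pos hκ] at h
    rw [h]
    refine (norm_add_le _ _).trans (add_le_add ((norm_sub_le _ _).trans ?_) ?_)
    · rw [two_mul]
      refine add_le_add (hV _ ?_) (hV _ ?_)
      · rw [abs_neg, abs_of_pos ht0]; exact ht1
      · rw [abs_of_pos ht0]; exact ht1
    · rw [Complex.norm_real, Real.norm_eq_abs, abs_mul, abs_of_pos (by norm_num : (0 : ℝ) < 4)]
  rw [Real.mul_rpow hC1 hI0, Real.mul_rpow hC2 hJ0] at e4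
  have e5 : |u (embt x' t)| = κ⁻¹ * (κ * |u (embt x' t)|) := by field_simp
  rw [e5]
  refine (mul_le_mul_of_nonneg_left e4 (by positivity)).trans ?_
  have p1 : 0 ≤ κ⁻¹ * (2 * (C0 * C1 ^ (9 / 10 : ℝ) * C2 ^ (1 / 10 : ℝ))) *
    |t * doubleLayer χ u x' t| := by positivity
  have p2 : 0 ≤ κ⁻¹ * 4 * (I ^ (9 / 10 : ℝ) * J ^ (1 / 10 : ℝ)) := by positivity
  linarith

theorem measurePreserving_embt (n : ℕ) :
    MeasurePreserving (fun p : ℝ × Euc n => embt p.2 p.1) := by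
  have h1 : MeasurePreserving (Prod.map id (WithLp.ofLp (p := 2)) : ℝ × Euc n → ℝ × (Fin n → ℝ)) :=
    (MeasurePreserving.id volume).prod (PiLp.volume_preserving_ofLp (Fin n))
  have h2 := (volume_preserving_piFinSuccAbove (fun _ : Fin (n + 1) => ℝ) (Fin.last n)).symm
  have h3 := (PiLp.volume_preserving_toLp (Fin (n + 1))).comp (h2.comp h1)
  refine (show (fun p : ℝ × Euc n => embt p.2 p.1) = _ from ?_) ▸ h3
  funext p
  simp [embt, MeasurableEquiv.piFinSuccAbove, Fin.insertNthEquiv, Fin.insertNth_last']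

theorem measurableEmbedding_embt (n : ℕ) :
    MeasurableEmbedding (fun p : ℝ × Euc n => embt p.2 p.1) := by
  refine (measurePreserving_embt n).measurable.measurableEmbedding fun p q h => ?_
  refine Prod.ext ?_ ?_
  · have := congrArg (fun x : Euc (n + 1) => x (Fin.last n)) h
    simpa [embt] using this
  · ext i
    have := congrArg (fun x : Euc (n + 1) => x i.castSucc) h
    simpa [embt] using this

theorem sq_lintegral_mul_le {Y : Type*} [MeasurableSpace Y] {μ : Measure Y} {f g : Y → ENNReal}
    (hf : AEMeasurable f μ) (hg : AEMeasurable g μ) :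
    (∫⁻ y, f y * g y ∂μ) ^ 2 ≤ (∫⁻ y, f y ^ 2 ∂μ) * ∫⁻ y, g y ^ 2 ∂μ := by
  have h := ENNReal.lintegral_mul_le_Lp_mul_Lq μ Real.HolderConjugate.two_two hf hg
  have h2 := pow_le_pow_left₀ (zero_le) h 2
  refine h2.trans_eq ?_
  rw [mul_pow, ← ENNReal.rpow_natCast, ← ENNReal.rpow_natCast, ← ENNReal.rpow_mul,
    ← ENNReal.rpow_mul]
  norm_num

theorem lintegral_sq_convolution_le {n : ℕ} {k f : Euc n → ENNReal} (hk : Measurable k)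
    (hf : Measurable f) :
    ∫⁻ x, (∫⁻ y, k (y - x) * f y) ^ 2 ≤ (∫⁻ z, k z) ^ 2 * ∫⁻ y, f y ^ 2 := by
  have h1 : ∀ x, (∫⁻ y, k (y - x) * f y) ^ 2 ≤ (∫⁻ z, k z) * ∫⁻ y, k (y - x) * f y ^ 2 := by
    intro x
    have hkx : Measurable fun y => k (y - x) := hk.comp (measurable_id.sub_const x)
    have e : ∀ a : ENNReal, a ^ (1 / 2 : ℝ) * a ^ (1 / 2 : ℝ) = a := fun a => by
      rw [← ENNReal.rpow_add_of_nonneg _ _ (by norm_num) (by norm_num)]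
      norm_num
    have h := sq_lintegral_mul_le (μ := volume) (f := fun y => k (y - x) ^ (1 / 2 : ℝ))
      (g := fun y => k (y - x) ^ (1 / 2 : ℝ) * f y) (hkx.pow_const _).aemeasurable
      ((hkx.pow_const _).mul hf).aemeasurable
    simp only [← mul_assoc, sq, e] at h
    simp only [sq]
    refine h.trans_eq ?_
    congr 1
    · exact lintegral_sub_right_eq_self k x
    · refine lintegral_congr fun y => ?_
      rw [show k (y - x) ^ (1 / 2 : ℝ) * f y * k (y - x) ^ (1 / 2 : ℝ) * f y =
        (k (y - x) ^ (1 / 2 : ℝ) * k (y - x) ^ (1 / 2 : ℝ)) * (f y * f y) by ring, e]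
  have hm : Measurable fun p : Euc n × Euc n => k (p.2 - p.1) * f p.2 ^ 2 :=
    (hk.comp (measurable_snd.sub measurable_fst)).mul ((hf.comp measurable_snd).pow_const 2)
  calc ∫⁻ x, (∫⁻ y, k (y - x) * f y) ^ 2
      ≤ ∫⁻ x, (∫⁻ z, k z) * ∫⁻ y, k (y - x) * f y ^ 2 := lintegral_mono h1
    _ = (∫⁻ z, k z) * ∫⁻ x, ∫⁻ y, k (y - x) * f y ^ 2 :=
        lintegral_const_mul _ hm.lintegral_prod_right'
    _ = (∫⁻ z, k z) * ∫⁻ y, ∫⁻ x, k (y - x) * f y ^ 2 := by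
        rw [lintegral_lintegral_swap hm.aemeasurable]
    _ = (∫⁻ z, k z) * ∫⁻ y, (∫⁻ z, k z) * f y ^ 2 := by
        congr 1
        refine lintegral_congr fun y => ?_
        rw [lintegral_mul_const _ (show Measurable fun x => k (y - x) from
          hk.comp (measurable_const.sub measurable_id)),
          lintegral_sub_left_eq_self k y]
    _ = (∫⁻ z, k z) ^ 2 * ∫⁻ y, f y ^ 2 := by
        rw [lintegral_const_mul _ (hf.pow_const 2), sq, mul_assoc]

/-- The total mass of the (unnormalized) Poisson kernel. -/
noncomputable def poissonMass (n : ℕ) : ℝ :=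
  ∫ z : Euc n, (1 + ‖z‖ ^ 2) ^ (-((n : ℝ) + 1) / 2)

theorem lintegral_poissonKernel (n : ℕ) {t : ℝ} (ht : 0 < t) :
    ∫⁻ z : Euc n, ENNReal.ofReal (t * radialKernel n (t ^ 2 + ‖z‖ ^ 2)) =
      ENNReal.ofReal (poissonMass n) := by
  have hQ : Integrable fun z : Euc n => (1 + ‖z‖ ^ 2) ^ (-((n : ℝ) + 1) / 2) := by
    refine integrable_rpow_neg_one_add_norm_sq ?_
    simp
  have hs : ∀ z : Euc n, t * radialKernel n (t ^ 2 + ‖z‖ ^ 2) =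
      (t ^ n)⁻¹ * (1 + ‖t⁻¹ • z‖ ^ 2) ^ (-((n : ℝ) + 1) / 2) := fun z => by
    have e1 : t ^ 2 + ‖z‖ ^ 2 = t ^ 2 * (1 + ‖t⁻¹ • z‖ ^ 2) := by
      rw [norm_smul, norm_inv, Real.norm_eq_abs, abs_of_pos ht]
      field_simp
    rw [radialKernel, e1, Real.mul_rpow (by positivity) (by positivity), ← mul_assoc]
    congr 1
    rw [← Real.rpow_natCast t 2, ← Real.rpow_mul ht.le, ← Real.rpow_natCast t n,
      ← Real.rpow_neg ht.le]
    nth_rewrite 1 [← Real.rpow_one t]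
    rw [← Real.rpow_add ht]
    congr 1
    push_cast
    ring
  have hi : Integrable fun z : Euc n =>
      (t ^ n)⁻¹ * (1 + ‖t⁻¹ • z‖ ^ 2) ^ (-((n : ℝ) + 1) / 2) :=
    (hQ.comp_smul (inv_ne_zero ht.ne')).const_mul _
  simp only [hs]
  rw [← ofReal_integral_eq_lintegral_ofReal hi (Filter.Eventually.of_forall fun z => by positivity),
    integral_const_mul, Measure.integral_comp_inv_smul_of_nonneg _
      (fun z : Euc n => (1 + ‖z‖ ^ 2) ^ (-((n : ℝ) + 1) / 2)) ht.le]
  congr 1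
  simp only [finrank_euclideanSpace, Fintype.card_fin, smul_eq_mul]
  rw [← mul_assoc, inv_mul_cancel₀ (by positivity), one_mul, poissonMass]

theorem ofReal_abs_mul_doubleLayer_le {n : ℕ} (χ u : Euc (n + 1) → ℝ) (x' : Euc n) {t : ℝ}
    (ht : 0 < t) :
    ENNReal.ofReal |t * doubleLayer χ u x' t| ≤
      ∫⁻ y', ENNReal.ofReal (t * radialKernel n (t ^ 2 + ‖y' - x'‖ ^ 2)) *
        ENNReal.ofReal |doubleDensity χ u y'| := by
  rw [doubleLayer, ← integral_const_mul, ← Real.norm_eq_abs, ofReal_norm]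
  refine (enorm_integral_le_lintegral_enorm _).trans_eq (lintegral_congr fun y => ?_)
  have h0 : 0 ≤ t * radialKernel n (t ^ 2 + ‖y - x'‖ ^ 2) := by
    unfold radialKernel
    positivity
  rw [← mul_assoc, enorm_mul, Real.enorm_of_nonneg h0, ← ofReal_norm, Real.norm_eq_abs]

theorem lintegral_poisson_sq_le {n : ℕ} {f : Euc n → ENNReal} (hf : Measurable f) {t : ℝ}
    (ht : 0 < t) :
    ∫⁻ x', (∫⁻ y', ENNReal.ofReal (t * radialKernel n (t ^ 2 + ‖y' - x'‖ ^ 2)) * f y') ^ 2 ≤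
      ENNReal.ofReal (poissonMass n) ^ 2 * ∫⁻ y', f y' ^ 2 := by
  have := lintegral_sq_convolution_le (n := n)
    (k := fun z => ENNReal.ofReal (t * radialKernel n (t ^ 2 + ‖z‖ ^ 2)))
    (ENNReal.measurable_ofReal.comp
      (((measurable_radialKernel n).comp (by fun_prop)).const_mul t)) hf
  rwa [lintegral_poissonKernel n ht] at this

theorem LpnormOn_nonneg {m : ℕ} (f : Euc m → ℝ) (p : ℝ) (S : Set (Euc m)) :
    0 ≤ LpnormOn f p S :=
  Real.rpow_nonneg ENNReal.toReal_nonneg _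

theorem LpnormOn_two_sq {m : ℕ} (f : Euc m → ℝ) (S : Set (Euc m)) :
    LpnormOn f 2 S ^ 2 = (∫⁻ x in S, ENNReal.ofReal |f x| ^ 2).toReal := by
  rw [LpnormOn, ← Real.rpow_natCast, ← Real.rpow_mul ENNReal.toReal_nonneg]
  norm_num
  congr 1
  refine lintegral_congr fun x => ?_
  rw [← sq_abs, ENNReal.ofReal_pow (abs_nonneg _)]

theorem lintegral_sq_ne_top {m : ℕ} {f : Euc m → ℝ} {S K : Set (Euc m)} (hK : IsCompact K)
    (hf : ContinuousOn f K) (hS : S ⊆ K) : ∫⁻ x in S, ENNReal.ofReal |f x| ^ 2 ≠ ⊤ := by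
  have h := ((hf.abs.pow 2).integrableOn_compact (μ := volume) hK).mono_set hS
  have h2 := h.2.ne
  refine ne_of_eq_of_ne (lintegral_congr fun x => ?_) h2
  simp only [Pi.pow_apply]
  rw [← ENNReal.ofReal_pow (abs_nonneg _), Real.enorm_of_nonneg (by positivity)]

theorem ofReal_LpnormOn_two_sq {m : ℕ} {f : Euc m → ℝ} {S K : Set (Euc m)} (hK : IsCompact K)
    (hf : ContinuousOn f K) (hS : S ⊆ K) :
    ENNReal.ofReal (LpnormOn f 2 S ^ 2) = ∫⁻ x in S, ENNReal.ofReal |f x| ^ 2 := by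
  rw [LpnormOn_two_sq, ENNReal.ofReal_toReal (lintegral_sq_ne_top hK hf hS)]

theorem setIntegral_abs_le_LpnormOn {m : ℕ} {f : Euc m → ℝ} {S K : Set (Euc m)}
    (hK : IsCompact K) (hf : ContinuousOn f K) (hS : S ⊆ K) :
    ∫ x in S, |f x| ≤ √(volume K).toReal * LpnormOn f 2 S := by
  have hi : IntegrableOn f S := (hf.integrableOn_compact hK).mono_set hS
  have hm : AEMeasurable (fun x => ENNReal.ofReal |f x|) (volume.restrict S) :=
    (hi.abs.1.aemeasurable).ennreal_ofReal
  have h := sq_lintegral_mul_le hm (aemeasurable_const (b := (1 : ENNReal)))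
  have hfin := lintegral_sq_ne_top hK hf hS
  simp only [mul_one, one_pow, lintegral_const, one_mul, Measure.restrict_apply_univ] at h
  have e : ∫ x in S, |f x| = (∫⁻ x in S, ENNReal.ofReal |f x|).toReal :=
    integral_eq_lintegral_of_nonneg_ae (Filter.Eventually.of_forall fun x => abs_nonneg _) hi.abs.1
  refine abs_le_of_sq_le_sq' ?_ (mul_nonneg (Real.sqrt_nonneg _) (LpnormOn_nonneg _ _ _)) |>.2
  rw [e, mul_pow, Real.sq_sqrt ENNReal.toReal_nonneg, LpnormOn_two_sq, mul_comm,
    ← ENNReal.toReal_mul, ← ENNReal.toReal_pow]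
  refine ENNReal.toReal_mono (ENNReal.mul_ne_top hfin hK.measure_lt_top.ne) ?_
  exact h.trans (mul_le_mul_right (measure_mono hS) _)

theorem lintegral_Bplus_le {n : ℕ} {F : Euc (n + 1) → ENNReal} {f : Euc n → ENNReal}
    (hf : Measurable f) {c d : ENNReal}
    (h : ∀ x' : Euc n, ‖x'‖ ≤ 1 → ∀ t : ℝ, 0 < t → t ≤ 1 / 2 → F (embt x' t) ≤ c + d *
      (∫⁻ y', ENNReal.ofReal (t * radialKernel n (t ^ 2 + ‖y' - x'‖ ^ 2)) * f y') ^ 2) :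
    ∫⁻ x in Bplus (0 : Euc (n + 1)) (1 / 2), F x ≤
      c * volume (Metric.closedBall (0 : Euc n) 1) +
        d * (ENNReal.ofReal (poissonMass n) ^ 2 * ∫⁻ y', f y' ^ 2) := by
  set P : ℝ × Euc n → ENNReal := fun p =>
    ∫⁻ y', ENNReal.ofReal (p.1 * radialKernel n (p.1 ^ 2 + ‖y' - p.2‖ ^ 2)) * f y' with hP
  have hPm : Measurable P := by
    refine Measurable.lintegral_prod_right'
      (f := fun q : (ℝ × Euc n) × Euc n =>
        ENNReal.ofReal (q.1.1 * radialKernel n (q.1.1 ^ 2 + ‖q.2 - q.1.2‖ ^ 2)) * f q.2) ?_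
    refine Measurable.mul (ENNReal.measurable_ofReal.comp ?_) (hf.comp measurable_snd)
    refine (measurable_fst.comp measurable_fst).mul ((measurable_radialKernel n).comp ?_)
    fun_prop
  set T : Set (ℝ × Euc n) := Set.Ioc (0 : ℝ) (1 / 2) ×ˢ Metric.closedBall (0 : Euc n) 1 with hT
  have hTm : MeasurableSet T := measurableSet_Ioc.prod Metric.isClosed_closedBall.measurableSet
  have hsub : (fun p : ℝ × Euc n => embt p.2 p.1) ⁻¹' Bplus 0 (1 / 2) ⊆ T := by
    rintro ⟨t, x'⟩ ⟨h1, h2⟩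
    simp only [embt_apply_last] at h1
    rw [dist_zero_right] at h2
    have e : ‖embt x' t‖ ^ 2 = t ^ 2 + ‖x'‖ ^ 2 := by
      have := norm_emb_sub_embt_sq x' 0 t
      have e0 : emb (0 : Euc n) = 0 := by rw [← norm_eq_zero, norm_emb, norm_zero]
      simpa [e0] using this
    have h3 : ‖embt x' t‖ ^ 2 ≤ (1 / 2) ^ 2 := by gcongr
    refine ⟨⟨h1, ?_⟩, ?_⟩
    · exact le_of_sq_le_sq (by nlinarith [sq_nonneg ‖x'‖]) (by norm_num)
    · rw [mem_closedBall_zero_iff]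
      nlinarith [sq_nonneg t, norm_nonneg x']
  have hvol : volume (Set.Ioc (0 : ℝ) (1 / 2)) ≤ 1 := by
    rw [Real.volume_Ioc, ENNReal.ofReal_le_one]
    norm_num
  have hT2 : ∫⁻ p in T, P p ^ 2 ≤ ENNReal.ofReal (poissonMass n) ^ 2 * ∫⁻ y', f y' ^ 2 := by
    calc ∫⁻ p in T, P p ^ 2
        ≤ ∫⁻ p in Set.Ioc (0 : ℝ) (1 / 2) ×ˢ (Set.univ : Set (Euc n)), P p ^ 2 :=
          lintegral_mono_set (Set.prod_mono subset_rfl (Set.subset_univ _))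
      _ = ∫⁻ t in Set.Ioc (0 : ℝ) (1 / 2), ∫⁻ x', P (t, x') ^ 2 := by
          rw [Measure.volume_eq_prod, ← Measure.prod_restrict, Measure.restrict_univ,
            lintegral_prod _ (hPm.pow_const 2).aemeasurable]
      _ ≤ ∫⁻ _ in Set.Ioc (0 : ℝ) (1 / 2),
            ENNReal.ofReal (poissonMass n) ^ 2 * ∫⁻ y', f y' ^ 2 :=
          setLIntegral_mono' measurableSet_Ioc fun t ht => lintegral_poisson_sq_le hf ht.1
      _ ≤ ENNReal.ofReal (poissonMass n) ^ 2 * ∫⁻ y', f y' ^ 2 := by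
          rw [setLIntegral_const]
          exact mul_le_of_le_one_right' hvol
  calc ∫⁻ x in Bplus (0 : Euc (n + 1)) (1 / 2), F x
      = ∫⁻ p in (fun p : ℝ × Euc n => embt p.2 p.1) ⁻¹' Bplus 0 (1 / 2), F (embt p.2 p.1) :=
        ((measurePreserving_embt n).setLIntegral_comp_preimage_emb (measurableEmbedding_embt n)
          F _).symm
    _ ≤ ∫⁻ p in T, F (embt p.2 p.1) := lintegral_mono_set hsub
    _ ≤ ∫⁻ p in T, (c + d * P p ^ 2) := setLIntegral_mono' hTm fun p hp =>
        h p.2 (by simpa using hp.2) p.1 hp.1.1 hp.1.2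
    _ = c * volume T + d * ∫⁻ p in T, P p ^ 2 := by
        rw [lintegral_add_left measurable_const, setLIntegral_const,
          lintegral_const_mul _ (hPm.pow_const 2)]
    _ ≤ _ := by
        refine add_le_add (mul_le_mul_right ?_ c) (mul_le_mul_right hT2 d)
        rw [hT, Measure.volume_eq_prod, Measure.prod_prod]
        exact mul_le_of_le_one_left' hvol

theorem Bplus_zero (n : ℕ) (r : ℝ) :
    Bplus (0 : Euc (n + 1)) r = upperHalf n ∩ Metric.closedBall 0 r := rfl

theorem Bprime_zero (n : ℕ) (r : ℝ) :
    Bprime (0 : Euc (n + 1)) r = Metric.closedBall (0 : Euc n) r := by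
  ext y'
  simp [Bprime, norm_emb]

theorem integral_abs_le_of_support {n : ℕ} {f g h : Euc n → ℝ} {B r : ℝ} (hB : 0 ≤ B)
    (hf : Continuous f) (hg : Continuous g) (hh : Continuous h) (h0 : ∀ y, r < ‖y‖ → f y = 0)
    (hb : ∀ y, |f y| ≤ B * (|g y| + |h y|)) :
    ∫ y, |f y| ≤ B * √(volume (Metric.closedBall (0 : Euc n) r)).toReal *
      (LpnormOn g 2 (Metric.closedBall 0 r) + LpnormOn h 2 (Metric.closedBall 0 r)) := by
  have hK := isCompact_closedBall (0 : Euc n) r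
  have e : ∫ y in Metric.closedBall (0 : Euc n) r, |f y| = ∫ y, |f y| :=
    setIntegral_eq_integral_of_forall_compl_eq_zero fun y hy => by
      rw [h0 y (by simpa using hy), abs_zero]
  have ig := (hg.abs.continuousOn.integrableOn_compact (μ := volume) hK)
  have ih := (hh.abs.continuousOn.integrableOn_compact (μ := volume) hK)
  have h1 := setIntegral_abs_le_LpnormOn hK hg.continuousOn subset_rfl
  have h2 := setIntegral_abs_le_LpnormOn hK hh.continuousOn subset_rfl
  rw [← e]
  calc ∫ y in Metric.closedBall (0 : Euc n) r, |f y|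
      ≤ ∫ y in Metric.closedBall (0 : Euc n) r, B * (|g y| + |h y|) :=
        integral_mono (hf.abs.continuousOn.integrableOn_compact hK) ((ig.add ih).const_mul B) hb
    _ = B * ((∫ y in Metric.closedBall (0 : Euc n) r, |g y|) +
          ∫ y in Metric.closedBall (0 : Euc n) r, |h y|) := by
        rw [integral_const_mul, integral_add ig ih]
    _ ≤ B * (√(volume (Metric.closedBall (0 : Euc n) r)).toReal *
          LpnormOn g 2 (Metric.closedBall 0 r) +
          √(volume (Metric.closedBall (0 : Euc n) r)).toReal *
          LpnormOn h 2 (Metric.closedBall 0 r)) := by gcongr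
    _ = _ := by ring

set_option maxHeartbeats 1000000 in
/-- The three-ball inequality at unit scale, centred at the origin. -/
theorem three_ball_inequality_unit (n : ℕ) :
    ∃ C : ℝ, 0 < C ∧ ∀ u : Euc (n + 1) → ℝ, ContDiffOn ℝ 1 u (closedHalf n) →
      HarmonicOnSet u (upperHalf n) →
        LpnormOn u 2 (Bplus 0 (1 / 2)) ≤
          C * (LpnormOn u 2 (Bplus 0 16) +
              LpnormOn (fun x' => u (emb x')) 2 (Bprime 0 16)) ^ (9 / 10 : ℝ) *
            (LpnormOn (normalDeriv u) 2 (Bprime 0 16) +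
              LpnormOn (fun x' => u (emb x')) 2 (Bprime 0 16)) ^ (1 / 10 : ℝ) := by
  obtain ⟨χ, hχ⟩ := exists_isCutoff (n + 1)
  obtain ⟨B, hB, hχB⟩ := hχ.exists_bound
  obtain ⟨C, hC, hCu⟩ := hχ.exists_abs_le
  have hA : 0 ≤ poissonMass n := integral_nonneg fun z => by positivity
  set A := poissonMass n with hAdef
  set b : ℝ := √(volume (Metric.closedBall (0 : Euc n) 16)).toReal with hb
  set c : ℝ := √(volume (closedHalf n ∩ Metric.closedBall (0 : Euc (n + 1)) 16)).toReal with hc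
  set v : ℝ := (volume (Metric.closedBall (0 : Euc n) 1)).toReal with hv
  have hv0 : 0 ≤ v := ENNReal.toReal_nonneg
  have hb0 : 0 ≤ b := Real.sqrt_nonneg _
  have hc0 : 0 ≤ c := Real.sqrt_nonneg _
  refine ⟨√2 * √v * (C * c ^ (9 / 10 : ℝ) * (2 * (B * b)) ^ (1 / 10 : ℝ)) +
    √2 * C * A * B + 1, by positivity, fun u hu hh => ?_⟩
  have hKc : IsCompact (Metric.closedBall (0 : Euc n) 16) := isCompact_closedBall _ _
  have hHc : IsCompact (closedHalf n ∩ Metric.closedBall (0 : Euc (n + 1)) 16) :=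
    (isCompact_closedBall _ _).inter_left (isClosed_closedHalf n)
  have hHu : ContinuousOn u (closedHalf n ∩ Metric.closedBall (0 : Euc (n + 1)) 16) :=
    hu.continuousOn.mono Set.inter_subset_left
  have hsub : Bplus (0 : Euc (n + 1)) 16 ⊆ closedHalf n ∩ Metric.closedBall 0 16 :=
    Set.inter_subset_inter_left _ (upperHalf_subset_closedHalf n)
  have hsub' : Bplus (0 : Euc (n + 1)) (1 / 2) ⊆ closedHalf n ∩ Metric.closedBall 0 16 :=
    Set.inter_subset_inter (upperHalf_subset_closedHalf n)
      (Metric.closedBall_subset_closedBall (by norm_num))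
  have hI := setIntegral_abs_le_LpnormOn hHc hHu hsub
  rw [Bprime_zero]
  have htr := continuous_trace hu
  have hnd := continuous_normalDeriv hu
  have hS := integral_abs_le_of_support hB (hχ.continuous_singleDensity hu) hnd htr
    (r := 16) (fun y hy => hχ.singleDensity_eq_zero hy) fun y => by
      unfold singleDensity
      refine (abs_sub _ _).trans ?_
      rw [abs_mul, abs_mul]
      have h1 := mul_le_mul_of_nonneg_right (hχB (emb y)).1 (abs_nonneg (normalDeriv u y))
      have h2 := mul_le_mul_of_nonneg_left (hχB (emb y)).2.2.1 (abs_nonneg (u (emb y)))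
      linarith
  have hdB : ∀ y, |doubleDensity χ u y| ≤ B * |u (emb y)| := fun y => by
    unfold doubleDensity
    rw [abs_mul]
    exact mul_le_mul_of_nonneg_right (hχB (emb y)).1 (abs_nonneg _)
  have hD := integral_abs_le_of_support hB (hχ.continuous_doubleDensity hu) hnd htr
    (r := 16) (fun y hy => hχ.doubleDensity_eq_zero hy) fun y => (hdB y).trans
      (mul_le_mul_of_nonneg_left (le_add_of_nonneg_left (abs_nonneg _)) hB)
  have hNd := ofReal_LpnormOn_two_sq hKc htr.continuousOn subset_rfl
  have hNh := ofReal_LpnormOn_two_sq hHc hHu hsub'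
  have hCu' := hCu u hu hh
  rw [← Bplus_zero] at hCu'
  set NH := LpnormOn u 2 (Bplus 0 16)
  set Nu := LpnormOn (fun x' => u (emb x')) 2 (Metric.closedBall 0 16)
  set Ng := LpnormOn (normalDeriv u) 2 (Metric.closedBall 0 16)
  set Nc := LpnormOn u 2 (Bplus 0 (1 / 2))
  have hNH0 : 0 ≤ NH := LpnormOn_nonneg _ _ _
  have hNu0 : 0 ≤ Nu := LpnormOn_nonneg _ _ _
  have hNg0 : 0 ≤ Ng := LpnormOn_nonneg _ _ _
  have hNc0 : 0 ≤ Nc := LpnormOn_nonneg _ _ _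
  set I := ∫ y in Bplus (0 : Euc (n + 1)) 16, |u y|
  set J := (∫ y', |singleDensity χ u y'|) + ∫ y', |doubleDensity χ u y'|
  have hI0 : 0 ≤ I := integral_nonneg fun y => abs_nonneg _
  have hJ0 : 0 ≤ J := add_nonneg (integral_nonneg fun y => abs_nonneg _)
    (integral_nonneg fun y => abs_nonneg _)
  have hJ : J ≤ 2 * (B * b) * (Ng + Nu) := by linarith
  set a := C * I ^ (9 / 10 : ℝ) * J ^ (1 / 10 : ℝ) with ha
  have ha0 : 0 ≤ a := by positivity
  have hfm : Measurable fun y' => ENNReal.ofReal |doubleDensity χ u y'| :=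
    ENNReal.measurable_ofReal.comp (hχ.continuous_doubleDensity hu).abs.measurable
  have hdd : ∫⁻ y', ENNReal.ofReal |doubleDensity χ u y'| ^ 2 ≤
      ENNReal.ofReal (B ^ 2 * Nu ^ 2) := by
    rw [ENNReal.ofReal_mul (by positivity), hNd,
      ← lintegral_indicator Metric.isClosed_closedBall.measurableSet,
      ← lintegral_const_mul' _ _ ENNReal.ofReal_ne_top]
    refine lintegral_mono fun y => ?_
    by_cases hy : y ∈ Metric.closedBall (0 : Euc n) 16
    · rw [Set.indicator_of_mem hy, ← ENNReal.ofReal_pow (abs_nonneg _),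
        ← ENNReal.ofReal_pow (abs_nonneg _), ← ENNReal.ofReal_mul (by positivity), ← mul_pow]
      exact ENNReal.ofReal_le_ofReal (pow_le_pow_left₀ (abs_nonneg _) (hdB y) 2)
    · rw [hχ.doubleDensity_eq_zero (by simpa using hy)]
      simp
  have hpt := lintegral_Bplus_le (n := n) (F := fun x => ENNReal.ofReal |u x| ^ 2) hfm
    (c := ENNReal.ofReal (2 * a ^ 2)) (d := ENNReal.ofReal (2 * C ^ 2)) (by
      intro x' hx' t ht0 ht1
      have h1 := hCu' x' hx' t ht0 ht1
      have h2 := ofReal_abs_mul_doubleLayer_le χ u x' ht0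
      have h3 : |u (embt x' t)| ^ 2 ≤
          2 * a ^ 2 + 2 * C ^ 2 * |t * doubleLayer χ u x' t| ^ 2 := by
        refine (pow_le_pow_left₀ (abs_nonneg _) h1 2).trans ?_
        nlinarith [sq_nonneg (a - C * |t * doubleLayer χ u x' t|)]
      rw [← ENNReal.ofReal_pow (abs_nonneg _)]
      refine (ENNReal.ofReal_le_ofReal h3).trans ?_
      rw [ENNReal.ofReal_add (by positivity) (by positivity),
        ENNReal.ofReal_mul (p := 2 * C ^ 2) (by positivity), ENNReal.ofReal_pow (abs_nonneg _)]
      gcongr)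
  have hsq : Nc ^ 2 ≤ 2 * a ^ 2 * v + 2 * C ^ 2 * (A ^ 2 * (B ^ 2 * Nu ^ 2)) := by
    rw [← ENNReal.ofReal_le_ofReal_iff (by positivity), hNh]
    refine hpt.trans ?_
    rw [ENNReal.ofReal_add (by positivity) (by positivity),
      ENNReal.ofReal_mul (p := 2 * a ^ 2) (by positivity),
      ENNReal.ofReal_mul (p := 2 * C ^ 2) (by positivity),
      ENNReal.ofReal_mul (p := A ^ 2) (by positivity), hv,
      ENNReal.ofReal_toReal (isCompact_closedBall _ _).measure_lt_top.ne, ENNReal.ofReal_pow hA]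
    gcongr
  have hNc : Nc ≤ √2 * √v * a + √2 * C * A * B * Nu := by
    refine le_of_sq_le_sq (hsq.trans ?_) (by positivity)
    have e1 : (√2) ^ 2 = 2 := Real.sq_sqrt (by norm_num)
    have e2 : (√v) ^ 2 = v := Real.sq_sqrt hv0
    have p : 0 ≤ (√2 * √v * a) * (√2 * C * A * B * Nu) := by positivity
    calc 2 * a ^ 2 * v + 2 * C ^ 2 * (A ^ 2 * (B ^ 2 * Nu ^ 2))
        = (√2) ^ 2 * a ^ 2 * (√v) ^ 2 + (√2) ^ 2 * C ^ 2 * (A ^ 2 * (B ^ 2 * Nu ^ 2)) := by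
          rw [e1, e2]
      _ ≤ _ := by nlinarith
  have hNu : Nu ≤ (NH + Nu) ^ (9 / 10 : ℝ) * (Ng + Nu) ^ (1 / 10 : ℝ) := by
    calc Nu = Nu ^ (9 / 10 : ℝ) * Nu ^ (1 / 10 : ℝ) := by
          rw [← Real.rpow_add_of_nonneg hNu0 (by norm_num) (by norm_num)]
          norm_num
      _ ≤ _ := by
          gcongr
          · exact le_add_of_nonneg_left hNH0
          · exact le_add_of_nonneg_left hNg0
  have ha1 : a ≤ (C * c ^ (9 / 10 : ℝ) * (2 * (B * b)) ^ (1 / 10 : ℝ)) *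
      ((NH + Nu) ^ (9 / 10 : ℝ) * (Ng + Nu) ^ (1 / 10 : ℝ)) := by
    calc a ≤ C * (c * (NH + Nu)) ^ (9 / 10 : ℝ) * (2 * (B * b) * (Ng + Nu)) ^ (1 / 10 : ℝ) := by
          rw [ha]
          gcongr
          exact hI.trans (mul_le_mul_of_nonneg_left (le_add_of_nonneg_right hNu0) hc0)
      _ = _ := by
          rw [Real.mul_rpow hc0 (by positivity), Real.mul_rpow (by positivity) (by positivity)]
          ring
  set G := (NH + Nu) ^ (9 / 10 : ℝ) * (Ng + Nu) ^ (1 / 10 : ℝ) with hG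
  have hG0 : 0 ≤ G := by positivity
  rw [mul_assoc, ← hG]
  calc Nc ≤ √2 * √v * a + √2 * C * A * B * Nu := hNc
    _ ≤ √2 * √v * ((C * c ^ (9 / 10 : ℝ) * (2 * (B * b)) ^ (1 / 10 : ℝ)) * G) +
        √2 * C * A * B * G := by gcongr
    _ ≤ _ := by nlinarith

theorem emb_add_smul {n : ℕ} (x' y' : Euc n) (R : ℝ) :
    emb (x' + R • y') = emb x' + R • emb y' := by
  ext i
  refine Fin.lastCases ?_ (fun j => ?_) i
  · simp [emb_apply_last]
  · simp [emb_apply_castSucc]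

theorem emb_add_smul_apply_last {n : ℕ} (x' : Euc n) (R : ℝ) (y : Euc (n + 1)) :
    (emb x' + R • y) (Fin.last n) = R * y (Fin.last n) := by
  simp [emb_apply_last]

theorem fderiv_comp_add_smul {m : ℕ} (f : Euc m → ℝ) (a : Euc m) (R : ℝ) (y : Euc m) :
    fderiv ℝ (fun z => f (a + R • z)) y = R • fderiv ℝ f (a + R • y) := by
  rw [fderiv_comp_smul (f := fun z => f (a + z)), fderiv_comp_add_left]

theorem lapl_comp_add_smul {m : ℕ} (f : Euc m → ℝ) (a : Euc m) (R : ℝ) (y : Euc m) :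
    lapl (fun z => f (a + R • z)) y = R ^ 2 * lapl f (a + R • y) := by
  unfold lapl
  rw [Finset.mul_sum]
  refine Finset.sum_congr rfl fun i _ => ?_
  simp only [fderiv_comp_add_smul, FunLike.coe_smul, Pi.smul_apply]
  rw [← Pi.smul_def, fderiv_const_smul_field, Pi.smul_apply,
    fderiv_comp_add_smul fun z => fderiv ℝ f z (EuclideanSpace.single i 1)]
  simp only [FunLike.coe_smul, Pi.smul_apply, smul_eq_mul]
  ring

theorem mapsTo_add_smul_upperHalf {n : ℕ} (x' : Euc n) {R : ℝ} (hR : 0 < R) :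
    Set.MapsTo (fun y => emb x' + R • y) (upperHalf n) (upperHalf n) := fun y hy => by
  show (0 : ℝ) < (emb x' + R • y) (Fin.last n)
  rw [emb_add_smul_apply_last]
  exact mul_pos hR hy

theorem mapsTo_add_smul_closedHalf {n : ℕ} (x' : Euc n) {R : ℝ} (hR : 0 < R) :
    Set.MapsTo (fun y => emb x' + R • y) (closedHalf n) (closedHalf n) := fun y hy => by
  show (0 : ℝ) ≤ (emb x' + R • y) (Fin.last n)
  rw [emb_add_smul_apply_last]
  exact mul_nonneg hR.le hy

theorem HarmonicOnSet.comp_add_smul {n : ℕ} {u : Euc (n + 1) → ℝ}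
    (hu : HarmonicOnSet u (upperHalf n)) (x' : Euc n) {R : ℝ} (hR : 0 < R) :
    HarmonicOnSet (fun y => u (emb x' + R • y)) (upperHalf n) := by
  refine ⟨hu.1.comp (by fun_prop) (mapsTo_add_smul_upperHalf x' hR), fun y hy => ?_⟩
  rw [lapl_comp_add_smul, hu.2 _ (mapsTo_add_smul_upperHalf x' hR hy), mul_zero]

theorem normalDeriv_comp_add_smul {n : ℕ} {u : Euc (n + 1) → ℝ}
    (hu : ContDiffOn ℝ 1 u (closedHalf n)) (x' : Euc n) {R : ℝ} (hR : 0 < R) (y' : Euc n) :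
    normalDeriv (fun y => u (emb x' + R • y)) y' = R * normalDeriv u (x' + R • y') := by
  have h1 : HasFDerivWithinAt u (fderivWithin ℝ u (closedHalf n) (emb x' + R • emb y'))
      (closedHalf n) (emb x' + R • emb y') :=
    ((hu.differentiableOn one_ne_zero) _
      (mapsTo_add_smul_closedHalf x' hR (emb_mem_closedHalf y'))).hasFDerivWithinAt
  have h2 : HasFDerivWithinAt (fun y : Euc (n + 1) => emb x' + R • y)
      (R • ContinuousLinearMap.id ℝ (Euc (n + 1))) (closedHalf n) (emb y') :=
    ((hasFDerivWithinAt_id _ _).const_smul R).const_add _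
  have h3 := (h1.comp (emb y') h2 (mapsTo_add_smul_closedHalf x' hR)).fderivWithin
    (uniqueDiffOn_closedHalf n _ (emb_mem_closedHalf y'))
  unfold normalDeriv
  rw [emb_add_smul]
  change fderivWithin ℝ (u ∘ fun y => emb x' + R • y) _ _ _ = _
  rw [h3]
  simp

theorem LpnormOn_comp_add_smul {m : ℕ} (f : Euc m → ℝ) (S : Set (Euc m)) (a : Euc m) {R : ℝ}
    (hR : 0 < R) :
    LpnormOn f 2 S = R ^ ((m : ℝ) / 2) *
      LpnormOn (fun y => f (a + R • y)) 2 ((fun y => a + R • y) ⁻¹' S) := by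
  have he : MeasurableEmbedding fun y : Euc m => a + R • y :=
    ((Homeomorph.smulOfNeZero R hR.ne').trans (Homeomorph.addLeft a)).measurableEmbedding
  have hmap : Measure.map (fun y : Euc m => a + R • y) volume =
      ENNReal.ofReal ((R ^ m)⁻¹) • volume := by
    rw [show (fun y : Euc m => a + R • y) = (a + ·) ∘ (R • ·) from rfl,
      ← Measure.map_map (by fun_prop) (by fun_prop), Measure.map_addHaar_smul _ hR.ne',
      Measure.map_smul, map_add_left_eq_self, finrank_euclideanSpace_fin,
      abs_of_pos (by positivity)]
  refine (sq_eq_sq₀ (LpnormOn_nonneg _ _ _)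
    (mul_nonneg (by positivity) (LpnormOn_nonneg _ _ _))).1 ?_
  have h := he.lintegral_map (μ := volume.restrict ((fun y : Euc m => a + R • y) ⁻¹' S))
    fun x => ENNReal.ofReal |f x| ^ 2
  rw [← he.restrict_map] at h
  rw [mul_pow, LpnormOn_two_sq, LpnormOn_two_sq, ← h, hmap, Measure.restrict_smul,
    lintegral_smul_measure, smul_eq_mul, ENNReal.toReal_mul,
    ENNReal.toReal_ofReal (by positivity), ← Real.rpow_natCast (R ^ _), ← Real.rpow_mul hR.le]
  have : R ^ m ≠ 0 := by positivity
  rw [Nat.cast_ofNat, div_mul_cancel₀ _ two_ne_zero, Real.rpow_natCast]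
  field_simp

theorem LpnormOn_const_mul {m : ℕ} (f : Euc m → ℝ) (S : Set (Euc m)) {R : ℝ} (hR : 0 ≤ R) :
    LpnormOn (fun y => R * f y) 2 S = R * LpnormOn f 2 S := by
  refine (sq_eq_sq₀ (LpnormOn_nonneg _ _ _) (mul_nonneg hR (LpnormOn_nonneg _ _ _))).1 ?_
  rw [mul_pow, LpnormOn_two_sq, LpnormOn_two_sq]
  have h : ∀ y, ENNReal.ofReal |R * f y| ^ 2 =
      ENNReal.ofReal R ^ 2 * ENNReal.ofReal |f y| ^ 2 := fun y => by
    rw [abs_mul, abs_of_nonneg hR, ENNReal.ofReal_mul hR, mul_pow]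
  simp_rw [h]
  rw [lintegral_const_mul' _ _ (ENNReal.pow_ne_top ENNReal.ofReal_ne_top), ENNReal.toReal_mul,
    ENNReal.toReal_pow, ENNReal.toReal_ofReal hR]

theorem dist_add_smul_le_iff {m : ℕ} (a y : Euc m) {r R : ℝ} (hR : 0 < R) :
    dist (a + R • y) a ≤ r * R ↔ dist y 0 ≤ r := by
  rw [dist_self_add_left, norm_smul, Real.norm_of_nonneg hR.le, dist_zero_right, mul_comm,
    mul_le_mul_iff_left₀ hR]

theorem preimage_Bplus {n : ℕ} (x' : Euc n) (r : ℝ) {R : ℝ} (hR : 0 < R) :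
    (fun y => emb x' + R • y) ⁻¹' Bplus (emb x') (r * R) = Bplus 0 r := by
  ext y
  simp only [Bplus, Set.mem_preimage, Set.mem_ofPred_eq, emb_add_smul_apply_last,
    dist_add_smul_le_iff _ _ hR, mul_pos_iff_of_pos_left hR]

theorem preimage_Bprime {n : ℕ} (x' : Euc n) (r : ℝ) {R : ℝ} (hR : 0 < R) :
    (fun y' => x' + R • y') ⁻¹' Bprime (emb x') (r * R) = Bprime 0 r := by
  ext y'
  simp only [Bprime, Set.mem_preimage, Set.mem_ofPred_eq, emb_add_smul,
    dist_add_smul_le_iff _ _ hR]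

/-- Three-ball-type interpolation inequality for harmonic functions on the upper half-space,
with `u = ũ(·, 0)` and `g = ∂_{n+1}ũ(·, 0)`: there are constants `C = C(n) > 0`,
`α = α(n) ∈ (0,1)`, `c = c(n) ∈ (0,1)` such that for all `x₀ ∈ ℝⁿ × {0}` and `R > 0`,
`‖ũ‖_{L²(B⁺_{cR}(x₀))} ≤ C (‖ũ‖_{L²(B⁺_{16R})} + R^{1/2}‖u‖_{L²(B'_{16R})})^α
  (R^{3/2}‖g‖_{L²(B'_{16R})} + R^{1/2}‖u‖_{L²(B'_{16R})})^{1−α}`. -/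
theorem three_ball_inequality_halfspace (n : ℕ) (hn : 1 ≤ n) :
    ∃ C > (0 : ℝ), ∃ α ∈ Set.Ioo (0 : ℝ) 1, ∃ c ∈ Set.Ioo (0 : ℝ) 1,
      ∀ u : EuclideanSpace ℝ (Fin (n+1)) → ℝ,
        ContDiffOn ℝ 1 u {x | 0 ≤ x (Fin.last n)} →
        HarmonicOnSet u {x | 0 < x (Fin.last n)} →
        ∀ (x0' : EuclideanSpace ℝ (Fin n)) (R : ℝ), 0 < R →
          LpnormOn u 2 (Bplus (emb x0') (c * R)) ≤
            C * (LpnormOn u 2 (Bplus (emb x0') (16 * R)) +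
                  R ^ ((1 : ℝ)/2) *
                    LpnormOn (fun x' => u (emb x')) 2 (Bprime (emb x0') (16 * R))) ^ α *
              (R ^ ((3 : ℝ)/2) *
                  LpnormOn (fun x' => fderivWithin ℝ u {x | 0 ≤ x (Fin.last n)} (emb x')
                    (EuclideanSpace.single (Fin.last n) 1)) 2 (Bprime (emb x0') (16 * R)) +
                R ^ ((1 : ℝ)/2) *
                  LpnormOn (fun x' => u (emb x')) 2 (Bprime (emb x0') (16 * R))) ^ (1 - α) := by
  obtain ⟨C, hC, hCu⟩ := three_ball_inequality_unit n
  refine ⟨C, hC, 9 / 10, by norm_num, 1 / 2, by norm_num, fun u hu hh x' R hR => ?_⟩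
  have h := hCu (fun y => u (emb x' + R • y))
    (hu.comp (by fun_prop) (mapsTo_add_smul_closedHalf x' hR)) (hh.comp_add_smul x' hR)
  change _ ≤ C * _ ^ _ * (_ * LpnormOn (normalDeriv u) _ _ + _) ^ _
  rw [funext (normalDeriv_comp_add_smul hu x' hR), LpnormOn_const_mul _ _ hR.le] at h
  simp only [← emb_add_smul] at h
  rw [LpnormOn_comp_add_smul u _ (emb x') hR, LpnormOn_comp_add_smul u _ (emb x') hR,
    LpnormOn_comp_add_smul _ (Bprime _ _) x' hR, LpnormOn_comp_add_smul (normalDeriv u) _ x' hR,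
    preimage_Bplus x' _ hR, preimage_Bplus x' _ hR, preimage_Bprime x' _ hR]
  set NH := LpnormOn (fun y => u (emb x' + R • y)) 2 (Bplus 0 16)
  set Nc := LpnormOn (fun y => u (emb x' + R • y)) 2 (Bplus 0 (1 / 2))
  set Ng := LpnormOn (fun y' => normalDeriv u (x' + R • y')) 2 (Bprime 0 16)
  set Nu := LpnormOn (fun y' => u (emb (x' + R • y'))) 2 (Bprime 0 16)
  have hNH : 0 ≤ NH := LpnormOn_nonneg _ _ _
  have hNg : 0 ≤ Ng := LpnormOn_nonneg _ _ _
  have hNu : 0 ≤ Nu := LpnormOn_nonneg _ _ _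
  set s : ℝ := R ^ (((n + 1 : ℕ) : ℝ) / 2) with hs
  have hs0 : 0 < s := by positivity
  have e1 : R ^ ((1 : ℝ) / 2) * R ^ ((n : ℝ) / 2) = s := by
    rw [← Real.rpow_add hR, hs]
    congr 1
    push_cast
    ring
  have e3 : R ^ ((3 : ℝ) / 2) * R ^ ((n : ℝ) / 2) = s * R := by
    rw [← e1, ← Real.rpow_add hR, ← Real.rpow_add hR, ← Real.rpow_add_one hR.ne']
    congr 1
    ring
  rw [← mul_assoc, e1, ← mul_assoc (R ^ ((3 : ℝ) / 2)), e3, mul_assoc s R, ← mul_add, ← mul_add,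
    Real.mul_rpow hs0.le (by positivity), Real.mul_rpow hs0.le (by positivity)]
  have es : s ^ (9 / 10 : ℝ) * s ^ (1 - 9 / 10 : ℝ) = s := by
    rw [← Real.rpow_add hs0]
    norm_num
  calc s * Nc ≤ s * _ := mul_le_mul_of_nonneg_left h hs0.le
    _ = (s ^ (9 / 10 : ℝ) * s ^ (1 - 9 / 10 : ℝ)) * (C * (NH + Nu) ^ (9 / 10 : ℝ) *
        (R * Ng + Nu) ^ (1 - 9 / 10 : ℝ)) := by
      rw [es]
      norm_num
    _ = _ := by ring
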